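/- Assume gcd(s+l,2l) = gcd(s,l) = d and d is odd. Let i = p^{m−1}(p−1) and λ = (p^m − p^{m−1} − 1)(p^{3s−d} − p^{3s−2d} + p^{3s−2d−1} + p^{3s−3d} − p^{m−2d} + 1). Then the distinct supports of the codewords of Hamming weight i in C form a 2-(p^m, i, λ) design on the point set F_q: each such support has exactly i elements, and every 2-element subset of F_q is contained in exactly λ of the distinct supports. -/

import Mathlib

/-- `trp p r z = z + z^p + ⋯ + z^(p^(r-1))`, the trace form used for `Tr_r`. -/
def trp (p r : ℕ) {F : Type} [Field F] (z : F) : F :=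
  ∑ i ∈ Finset.range r, z ^ p ^ i

/-- The codeword `c(a,b,c,h)` of the code `C`, viewed as a function on `F_q = F`;
its value at `x` is `Tr_s(a x^(p^s+1)) + Tr_m(b x^(p^l+1) + c x) + h` (the values
lie in the prime field `F_p ⊆ F`). Here `m = 2s`. -/
def cword (p s l : ℕ) {F : Type} [Field F] (a b c : F) (h : ZMod p) : F → F :=
  fun x => trp p s (a * x ^ (p ^ s + 1)) + trp p (2 * s) (b * x ^ (p ^ l + 1) + c * x)
    + ZMod.cast h

/-- The support of the codeword `c(a,b,c,h)`; its cardinality is the Hamming weight. -/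
def suppw (p s l : ℕ) {F : Type} [Field F] [Fintype F] [DecidableEq F]
    (a b c : F) (h : ZMod p) : Finset F :=
  Finset.univ.filter fun x => cword p s l a b c h x ≠ 0

open Finset

section QuadraticFibres

variable {p : ℕ} [Fact p.Prime]

/-- A function that some translation shifts by every given constant is balanced. -/
theorem card_fibre_of_translate {V : Type} [AddCommGroup V] [Fintype V] (f : V → ZMod p)
    (hf : ∀ c, ∃ u, ∀ x, f (x + u) = f x + c) (c : ZMod p) :
    p * #{x | f x = c} = Fintype.card V := by
  have key : ∀ c, #{x | f x = c} = #{x | f x = 0} := by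
    intro c
    obtain ⟨u, hu⟩ := hf c
    symm
    refine card_bij (fun x _ => x + u) ?_ ?_ ?_
    · intro x hx
      simp only [mem_filter, mem_univ, true_and] at hx ⊢
      rw [hu, hx, zero_add]
    · intro x _ y _ h
      exact add_right_cancel h
    · intro y hy
      refine ⟨y - u, ?_, by simp⟩
      simp only [mem_filter, mem_univ, true_and] at hy ⊢
      have := hu (y - u)
      rw [sub_add_cancel, hy] at this
      exact left_eq_add.mp ((add_comm c _ ▸ this : c = c + f (y - u)))
  have := card_eq_sum_card_fiberwise (s := (univ : Finset V)) (t := (univ : Finset (ZMod p)))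
    (f := f) (by simp)
  rw [Finset.sum_congr rfl (fun c _ => key c)] at this
  rw [key c]
  simpa [ZMod.card] using this.symm

theorem zmod_two_ne_zero (hp : Odd p) : (2 : ZMod p) ≠ 0 := by
  have h2 : ringChar (ZMod p) ≠ 2 := by
    rw [ZMod.ringChar_zmod_n]
    rintro rfl
    exact absurd hp (by decide)
  exact Ring.two_ne_zero h2

variable {V : Type} [AddCommGroup V] [Module (ZMod p) V]

/-- The quadratic function `x ↦ B x x / 2` attached to a symmetric bilinear form. -/
def halfQuad (B : V →ₗ[ZMod p] V →ₗ[ZMod p] ZMod p) (x : V) : ZMod p := 2⁻¹ * B x x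

theorem halfQuad_add (hp : Odd p) (B : V →ₗ[ZMod p] V →ₗ[ZMod p] ZMod p)
    (hB : ∀ x y, B x y = B y x) (x y : V) :
    halfQuad B (x + y) = halfQuad B x + halfQuad B y + B x y := by
  have h2 := zmod_two_ne_zero hp
  simp only [halfQuad, map_add, LinearMap.add_apply, hB y x]
  field_simp
  ring

theorem halfQuad_smul (B : V →ₗ[ZMod p] V →ₗ[ZMod p] ZMod p) (t : ZMod p) (x : V) :
    halfQuad B (t • x) = t ^ 2 * halfQuad B x := by
  simp only [halfQuad, map_smul, LinearMap.smul_apply, smul_eq_mul]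
  ring

theorem halfQuad_of_radical (B : V →ₗ[ZMod p] V →ₗ[ZMod p] ZMod p) {u : V} (hu : B u = 0) :
    halfQuad B u = 0 := by
  simp [halfQuad, hu]

variable [Fintype V]

theorem card_fibre_linear (ψ : V →ₗ[ZMod p] ZMod p) (hψ : ψ ≠ 0) (c : ZMod p) :
    p * #{x | ψ x = c} = Fintype.card V := by
  obtain ⟨v, hv⟩ : ∃ v, ψ v ≠ 0 := by
    by_contra! h
    exact hψ (LinearMap.ext h)
  refine card_fibre_of_translate ψ (fun c => ⟨(c / ψ v) • v, fun x => ?_⟩) c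
  rw [map_add, map_smul, smul_eq_mul, div_mul_cancel₀ _ hv]

/-- The number of points at which `halfQuad B` takes a given value. -/
def fibreCard (B : V →ₗ[ZMod p] V →ₗ[ZMod p] ZMod p) (h : ZMod p) : ℕ :=
  #{x | halfQuad B x = h}

/-- The number of points in the radical of a bilinear form. -/
def radCard (B : V →ₗ[ZMod p] V →ₗ[ZMod p] ZMod p) : ℕ := #{u | B u = 0}

theorem sum_fibreCard (B : V →ₗ[ZMod p] V →ₗ[ZMod p] ZMod p) :
    ∑ h, fibreCard B h = Fintype.card V := by
  have := card_eq_sum_card_fiberwise (s := (univ : Finset V)) (t := (univ : Finset (ZMod p)))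
    (f := halfQuad B) (by simp)
  simpa [fibreCard] using this.symm

theorem sum_fibreCard_sq (hp : Odd p) (B : V →ₗ[ZMod p] V →ₗ[ZMod p] ZMod p)
    (hB : ∀ x y, B x y = B y x) :
    (p : ℤ) * ∑ h, (fibreCard B h : ℤ) ^ 2
      = (Fintype.card V : ℤ) ^ 2 + (p - 1) * (Fintype.card V * radCard B) := by
  have h1 : ∑ h, (fibreCard B h) ^ 2 = ∑ u : V, #{x | halfQuad B (x + u) = halfQuad B x} := by
    have e1 : ∑ h, (fibreCard B h) ^ 2 = ∑ x : V, #{y | halfQuad B y = halfQuad B x} := by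
      rw [← Finset.sum_fiberwise (s := univ) (g := halfQuad B)]
      refine Finset.sum_congr rfl fun h _ => ?_
      rw [Finset.sum_congr rfl (g := fun _ => fibreCard B h)]
      · simp [fibreCard, sq]
      · intro x hx
        simp only [mem_filter, mem_univ, true_and] at hx
        rw [hx, fibreCard]
    rw [e1]
    simp only [card_filter]
    rw [Finset.sum_comm (s := (univ : Finset V)) (t := (univ : Finset V))
      (f := fun u x => if halfQuad B (x + u) = halfQuad B x then 1 else 0)]
    refine Finset.sum_congr rfl fun x _ => ?_
    exact (Equiv.sum_comp (Equiv.addLeft x)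
      (fun y => if halfQuad B y = halfQuad B x then 1 else 0)).symm
  have h2 : ∀ u : V, p * #{x | halfQuad B (x + u) = halfQuad B x}
      = if B u = 0 then p * Fintype.card V else Fintype.card V := by
    intro u
    split_ifs with hu
    · congr 1
      rw [← card_univ]
      congr 1
      ext x
      simp [halfQuad_add hp B hB, halfQuad_of_radical B hu, hB x u, hu]
    · rw [← card_fibre_linear (B u) hu (- halfQuad B u)]
      congr 2
      ext x
      simp only [mem_filter, mem_univ, true_and, halfQuad_add hp B hB, hB x u]
      constructor <;> intro h <;> linear_combination h
  have h3 : p * ∑ h, (fibreCard B h) ^ 2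
      = radCard B * (p * Fintype.card V) + #{u | ¬ B u = 0} * Fintype.card V := by
    rw [h1, Finset.mul_sum, Finset.sum_congr rfl fun u _ => h2 u, Finset.sum_ite]
    simp [radCard]
  have h4 : radCard B + #{u | ¬ B u = 0} = Fintype.card V := by
    rw [radCard, card_filter_add_card_filter_not, card_univ]
  have h3' : (p : ℤ) * ∑ h, (fibreCard B h : ℤ) ^ 2
      = radCard B * (p * Fintype.card V) + #{u | ¬ B u = 0} * Fintype.card V := by
    exact_mod_cast h3
  have h4' : (radCard B : ℤ) + #{u | ¬ B u = 0} = Fintype.card V := by exact_mod_cast h4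
  rw [h3']
  linear_combination (Fintype.card V : ℤ) * h4'

/-- The deviation of a fibre of `halfQuad B` from the balanced size, scaled by `p`. -/
def fibreDev (B : V →ₗ[ZMod p] V →ₗ[ZMod p] ZMod p) (h : ZMod p) : ℤ :=
  p * fibreCard B h - Fintype.card V

theorem sum_fibreDev (B : V →ₗ[ZMod p] V →ₗ[ZMod p] ZMod p) : ∑ h, fibreDev B h = 0 := by
  have : ∑ h, (fibreCard B h : ℤ) = Fintype.card V := by exact_mod_cast sum_fibreCard B
  simp only [fibreDev, Finset.sum_sub_distrib, ← Finset.mul_sum, this]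
  simp [ZMod.card]

theorem sum_fibreDev_sq (hp : Odd p) (B : V →ₗ[ZMod p] V →ₗ[ZMod p] ZMod p)
    (hB : ∀ x y, B x y = B y x) :
    ∑ h, fibreDev B h ^ 2 = p * (p - 1) * (Fintype.card V * radCard B) := by
  have h1 : ∑ h, (fibreCard B h : ℤ) = Fintype.card V := by exact_mod_cast sum_fibreCard B
  have h2 := sum_fibreCard_sq hp B hB
  have h3 : ∀ h, fibreDev B h ^ 2 = p ^ 2 * (fibreCard B h : ℤ) ^ 2
      - 2 * p * Fintype.card V * fibreCard B h + (Fintype.card V : ℤ) ^ 2 := by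
    intro h; rw [fibreDev]; ring
  simp only [h3, Finset.sum_sub_distrib, Finset.sum_add_distrib, ← Finset.mul_sum, h1]
  simp only [sum_const, card_univ, ZMod.card, nsmul_eq_mul]
  linear_combination (p : ℤ) * h2

theorem fibreDev_sq_lt (hp : Odd p) (B : V →ₗ[ZMod p] V →ₗ[ZMod p] ZMod p)
    (hB : ∀ x y, B x y = B y x) (h : ZMod p) :
    fibreDev B h ^ 2 < p ^ 2 * (Fintype.card V * radCard B) := by
  have h1 := Finset.single_le_sum (s := univ) (f := fun h => fibreDev B h ^ 2)
    (fun i _ => sq_nonneg _) (mem_univ h)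
  rw [sum_fibreDev_sq hp B hB] at h1
  have hn : 0 < Fintype.card V := Fintype.card_pos
  have hr : 0 < radCard B := card_pos.mpr ⟨0, by simp⟩
  have hpp : 0 < p := (Fact.out : p.Prime).pos
  have : (0 : ℤ) < p * (Fintype.card V * radCard B) := by positivity
  nlinarith

theorem fibreCard_sq_mul (B : V →ₗ[ZMod p] V →ₗ[ZMod p] ZMod p) {t : ZMod p} (ht : t ≠ 0)
    (h : ZMod p) : fibreCard B (t ^ 2 * h) = fibreCard B h := by
  symm
  refine card_bij (fun x _ => t • x) ?_ ?_ ?_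
  · intro x hx
    simp only [mem_filter, mem_univ, true_and] at hx ⊢
    rw [halfQuad_smul, hx]
  · intro x _ y _ h
    exact smul_right_injective V ht h
  · intro y hy
    refine ⟨t⁻¹ • y, ?_, by simp [ht]⟩
    simp only [mem_filter, mem_univ, true_and] at hy ⊢
    rw [halfQuad_smul, hy]
    field_simp

theorem even_fibreCard (hp : Odd p) (B : V →ₗ[ZMod p] V →ₗ[ZMod p] ZMod p) {h : ZMod p}
    (hh : h ≠ 0) : Even (fibreCard B h) := by
  have h2 := zmod_two_ne_zero hp
  have key : ∑ x ∈ ({x | halfQuad B x = h} : Finset V), (1 : ZMod 2) = 0 := by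
    refine Finset.sum_involution (fun x _ => -x) ?_ ?_ ?_ ?_
    · intro x _; decide
    · intro x hx _ hneg
      simp only [mem_filter, mem_univ, true_and] at hx
      have h3 : (2 : ZMod p) • x = 0 := by
        rw [two_smul]; nth_rewrite 1 [← hneg]; simp
      have hx0 : x = 0 := by simpa [h2] using h3
      apply hh
      rw [← hx, hx0]
      simp [halfQuad]
    · intro x hx
      simp only [mem_filter, mem_univ, true_and] at hx ⊢
      rw [← hx]
      simp [halfQuad]
    · intro x _; simp
  rw [← ZMod.natCast_eq_zero_iff_even, fibreCard]
  simpa using key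

theorem prime_mul_sq_add_sq_eq_pow {p : ℕ} (hpp : p.Prime) (g : ℕ) :
    ∀ a b : ℤ, p * a ^ 2 + b ^ 2 = p ^ g → (Even g → a = 0) ∧ (Odd g → b = 0) := by
  have hp2 : (2 : ℤ) ≤ p := by exact_mod_cast hpp.two_le
  induction g with
  | zero =>
    intro a b h
    refine ⟨fun _ => ?_, fun h => absurd h (by decide)⟩
    by_contra ha
    have : 0 < a ^ 2 := by positivity
    rw [pow_zero] at h
    nlinarith [sq_nonneg b]
  | succ g ih =>
    intro a b h
    have hb : (p : ℤ) ∣ b := by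
      have : (p : ℤ) ∣ b ^ 2 := ⟨p ^ g - a ^ 2, by rw [pow_succ] at h; linear_combination h⟩
      exact (Nat.prime_iff_prime_int.mp hpp).dvd_of_dvd_pow this
    obtain ⟨b', rfl⟩ := hb
    have h' : (p : ℤ) * b' ^ 2 + a ^ 2 = p ^ g := by
      have : (p : ℤ) * (p * b' ^ 2 + a ^ 2) = p * p ^ g := by
        rw [pow_succ] at h; linear_combination h
      exact mul_left_cancel₀ (by positivity) this
    obtain ⟨h1, h2⟩ := ih b' a h'
    constructor
    · intro he
      have hg : Odd g := by
        rcases Nat.even_or_odd g with h | h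
        · exact absurd he (by simpa using h.add_one)
        · exact h
      exact h2 hg
    · intro ho
      have hg : Even g := by
        rcases Nat.even_or_odd g with h | h
        · exact h
        · exact absurd ho (by simpa using h.add_one)
      rw [h1 hg, mul_zero]

/-- A nonsquare `ν` splits the sum of a function invariant under multiplication by squares. -/
theorem exists_nonsquare_sum (hp : Odd p) : ∃ ν : ZMod p, ν ≠ 0 ∧
    (∀ h : ZMod p, h ≠ 0 → (∃ t ≠ 0, h = t ^ 2 * 1) ∨ (∃ t ≠ 0, h = t ^ 2 * ν)) ∧
    ∀ g : ZMod p → ℤ, (∀ t h, t ≠ 0 → g (t ^ 2 * h) = g h) →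
      2 * ∑ h, g h = 2 * g 0 + (p - 1) * (g 1 + g ν) := by
  have h2 : ringChar (ZMod p) ≠ 2 := by
    rw [ZMod.ringChar_zmod_n]
    rintro rfl
    exact absurd hp (by decide)
  obtain ⟨ν, hν⟩ := quadraticChar_exists_neg_one h2
  have hν0 : ν ≠ 0 := by rintro rfl; simp at hν
  have hns : ¬ IsSquare ν := quadraticChar_neg_one_iff_not_isSquare.mp hν
  have hcase : ∀ h : ZMod p, h ≠ 0 →
      (quadraticChar (ZMod p) h = 1 ∧ ∃ t ≠ 0, h = t ^ 2 * 1) ∨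
      (quadraticChar (ZMod p) h = -1 ∧ ∃ t ≠ 0, h = t ^ 2 * ν) := by
    intro h hh
    rcases quadraticChar_dichotomy hh with h1 | h1
    · left
      refine ⟨h1, ?_⟩
      obtain ⟨t, ht⟩ := (quadraticChar_one_iff_isSquare hh).mp h1
      refine ⟨t, ?_, by rw [ht]; ring⟩
      rintro rfl
      simp at ht
      exact hh ht
    · right
      refine ⟨h1, ?_⟩
      have h3 : quadraticChar (ZMod p) (h / ν) = 1 := by
        have : quadraticChar (ZMod p) (h / ν * ν) = -1 := by rw [div_mul_cancel₀ _ hν0, h1]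
        rw [map_mul, hν] at this
        linarith
      obtain ⟨t, ht⟩ := (quadraticChar_one_iff_isSquare (div_ne_zero hh hν0)).mp h3
      refine ⟨t, ?_, ?_⟩
      · rintro rfl
        simp [hh, hν0] at ht
      · field_simp at ht
        rw [ht]; ring
  refine ⟨ν, hν0, fun h hh => (hcase h hh).imp And.right And.right, fun g hg => ?_⟩
  have key : ∀ h, 2 * g h = (if h = 0 then 2 * g 0 - (g 1 + g ν) else 0)
      + ((g 1 + g ν) + quadraticChar (ZMod p) h * (g 1 - g ν)) := by
    intro h
    by_cases hh : h = 0
    · simp [hh]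
    · rcases hcase h hh with ⟨h1, t, ht, rfl⟩ | ⟨h1, t, ht, rfl⟩
      · rw [if_neg hh, h1, hg _ _ ht]; ring
      · rw [if_neg hh, h1, hg _ _ ht]; ring
  rw [Finset.mul_sum, Finset.sum_congr rfl fun h _ => key h, Finset.sum_add_distrib,
    Finset.sum_add_distrib, ← Finset.sum_mul, quadraticChar_sum_zero h2]
  simp [ZMod.card]
  ring

theorem card_fibreDev_eq_zero (hp : Odd p) (B : V →ₗ[ZMod p] V →ₗ[ZMod p] ZMod p)
    (hB : ∀ x y, B x y = B y x) {m ρ : ℕ} (hm : Even m) (hV : Fintype.card V = p ^ m)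
    (hρ : radCard B = p ^ ρ) :
    #{h | fibreDev B h = 0} = if Odd ρ then 1 else 0 := by
  have hpp : p.Prime := Fact.out
  obtain ⟨ν, hν0, hcase, hsum⟩ := exists_nonsquare_sum hp
  have hinv : ∀ t h, t ≠ 0 → fibreDev B (t ^ 2 * h) = fibreDev B h := by
    intro t h ht
    rw [fibreDev, fibreDev, fibreCard_sq_mul B ht]
  have s1 := hsum (fibreDev B) hinv
  have s2 := hsum (fun h => fibreDev B h ^ 2) (fun t h ht => by simp only [hinv t h ht])
  rw [sum_fibreDev] at s1
  simp only [sum_fibreDev_sq hp B hB, hV, hρ] at s2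
  obtain ⟨k1, hk1⟩ := even_fibreCard hp B (h := 1) one_ne_zero
  obtain ⟨kν, hkν⟩ := even_fibreCard hp B hν0
  have d1 : fibreDev B 1 = 2 * p * k1 - Fintype.card V := by
    rw [fibreDev, hk1]; push_cast; ring
  have dν : fibreDev B ν = 2 * p * kν - Fintype.card V := by
    rw [fibreDev, hkν]; push_cast; ring
  obtain ⟨a, ha⟩ : ∃ a : ℤ, fibreDev B 1 + fibreDev B ν = 2 * a :=
    ⟨p * k1 + p * kν - Fintype.card V, by rw [d1, dν]; ring⟩
  obtain ⟨b, hb⟩ : ∃ b : ℤ, fibreDev B 1 - fibreDev B ν = 2 * b :=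
    ⟨p * k1 - p * kν, by rw [d1, dν]; ring⟩
  have e1 : fibreDev B 1 = a + b := by linarith
  have eν : fibreDev B ν = a - b := by linarith
  have e0 : fibreDev B 0 = - (p - 1) * a := by rw [ha] at s1; linarith
  have hp1 : (p : ℤ) - 1 ≠ 0 := by
    have : (2 : ℤ) ≤ p := by exact_mod_cast hpp.two_le
    linarith
  have key : (p : ℤ) * a ^ 2 + b ^ 2 = p ^ (m + ρ + 1) := by
    rw [e0, e1, eν] at s2
    have : 2 * ((p : ℤ) - 1) * (p * a ^ 2 + b ^ 2) = 2 * ((p : ℤ) - 1) * p ^ (m + ρ + 1) := by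
      push_cast at s2
      rw [pow_succ, pow_add]
      linear_combination -s2
    exact mul_left_cancel₀ (by simpa using hp1) this
  have hpos : (0 : ℤ) < p ^ (m + ρ + 1) := by
    have := hpp.pos
    positivity
  obtain ⟨ka, kb⟩ := prime_mul_sq_add_sq_eq_pow hpp _ a b key
  split_ifs with hodd
  · have ha0 : a = 0 := ka (by
      have := (hm.add_odd hodd).add_one
      exact this)
    have hb0 : b ≠ 0 := by
      rintro rfl
      rw [ha0] at key
      simp only [ne_eq, OfNat.ofNat_ne_zero, not_false_eq_true, zero_pow, mul_zero,
        add_zero] at key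
      exact hpos.ne key
    rw [card_eq_one]
    refine ⟨0, ?_⟩
    ext h
    simp only [mem_filter, mem_univ, true_and, mem_singleton]
    constructor
    · intro hz
      by_contra hh
      rcases hcase h hh with ⟨t, ht, rfl⟩ | ⟨t, ht, rfl⟩
      · rw [hinv _ _ ht, e1, ha0] at hz
        simp at hz
        exact hb0 hz
      · rw [hinv _ _ ht, eν, ha0] at hz
        simp at hz
        exact hb0 hz
    · rintro rfl
      rw [e0, ha0, mul_zero]
  · have hb0 : b = 0 := kb (hm.add (Nat.not_odd_iff_even.mp hodd)).add_one
    have ha0 : a ≠ 0 := by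
      rintro rfl
      rw [hb0] at key
      simp only [ne_eq, OfNat.ofNat_ne_zero, not_false_eq_true, zero_pow, mul_zero,
        add_zero] at key
      exact hpos.ne key
    rw [card_eq_zero, filter_eq_empty_iff]
    intro h _ hz
    by_cases hh : h = 0
    · rw [hh, e0] at hz
      rcases mul_eq_zero.mp hz with h | h
      · exact hp1 (by linarith)
      · exact ha0 h
    · rcases hcase h hh with ⟨t, ht, rfl⟩ | ⟨t, ht, rfl⟩
      · rw [hinv _ _ ht, e1, hb0] at hz
        exact ha0 (by linarith)
      · rw [hinv _ _ ht, eν, hb0] at hz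
        exact ha0 (by linarith)

/-- The fibres of `x ↦ halfQuad B x + φ x + h` over zero. -/
theorem zeros_of_mem_radical (hp : Odd p) (B : V →ₗ[ZMod p] V →ₗ[ZMod p] ZMod p)
    (hB : ∀ x y, B x y = B y x) (φ : V →ₗ[ZMod p] ZMod p)
    (hφ : ∀ u, B u = 0 → φ u = 0) :
    ∃ k : ZMod p, ∀ h, #{x | halfQuad B x + φ x + h = 0} = fibreCard B (k - h) := by
  have hmem : φ ∈ (LinearMap.ker B).dualAnnihilator := by
    rw [Submodule.mem_dualAnnihilator]
    intro u hu
    exact hφ u hu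
  rw [LinearMap.dualAnnihilator_ker_eq_range_flip] at hmem
  obtain ⟨v, hv⟩ := hmem
  have hv' : ∀ x, φ x = B x v := fun x => by rw [← hv]; rfl
  refine ⟨halfQuad B v, fun h => ?_⟩
  refine card_bij (fun x _ => x + v) ?_ ?_ ?_
  · intro x hx
    simp only [mem_filter, mem_univ, true_and] at hx ⊢
    rw [halfQuad_add hp B hB, ← hv']
    linear_combination hx
  · intro x _ y _ h
    exact add_right_cancel h
  · intro y hy
    refine ⟨y - v, ?_, by simp⟩
    simp only [mem_filter, mem_univ, true_and] at hy ⊢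
    have := halfQuad_add hp B hB (y - v) v
    rw [sub_add_cancel, hy] at this
    rw [hv']
    linear_combination -this

theorem zeros_of_not_mem_radical (hp : Odd p) (B : V →ₗ[ZMod p] V →ₗ[ZMod p] ZMod p)
    (hB : ∀ x y, B x y = B y x) (φ : V →ₗ[ZMod p] ZMod p)
    {u : V} (hu : B u = 0) (hφ : φ u ≠ 0) (h : ZMod p) :
    p * #{x | halfQuad B x + φ x + h = 0} = Fintype.card V := by
  refine card_fibre_of_translate (fun x => halfQuad B x + φ x + h)
    (fun c => ⟨(c / φ u) • u, fun x => ?_⟩) 0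
  have h1 : B ((c / φ u) • u) = 0 := by rw [map_smul, hu, smul_zero]
  rw [halfQuad_add hp B hB, halfQuad_of_radical B h1, hB x, h1, map_add, map_smul, smul_eq_mul,
    div_mul_cancel₀ _ hφ, LinearMap.zero_apply]
  ring

/-- The number of zeros of `halfQuad B + φ + h` is close to the average. -/
theorem zeros_dev_sq_lt (hp : Odd p) (B : V →ₗ[ZMod p] V →ₗ[ZMod p] ZMod p)
    (hB : ∀ x y, B x y = B y x) (φ : V →ₗ[ZMod p] ZMod p) (h : ZMod p) :
    ((p : ℤ) * #{x | halfQuad B x + φ x + h = 0} - Fintype.card V) ^ 2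
      < p ^ 2 * (Fintype.card V * radCard B) := by
  by_cases hφ : ∀ u, B u = 0 → φ u = 0
  · obtain ⟨k, hk⟩ := zeros_of_mem_radical hp B hB φ hφ
    rw [hk h]
    exact fibreDev_sq_lt hp B hB (k - h)
  · push Not at hφ
    obtain ⟨u, hu, hφu⟩ := hφ
    have := zeros_of_not_mem_radical hp B hB φ hu hφu h
    have h' : (p : ℤ) * #{x | halfQuad B x + φ x + h = 0} = Fintype.card V := by
      exact_mod_cast this
    have h0 := fibreDev_sq_lt hp B hB 0
    rw [h', sub_self]
    nlinarith [sq_nonneg (fibreDev B 0)]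

theorem card_annihilator_radical (B : V →ₗ[ZMod p] V →ₗ[ZMod p] ZMod p)
    (hB : ∀ x y, B x y = B y x) (e : V ≃ₗ[ZMod p] Module.Dual (ZMod p) V) :
    #{c | ∀ u, B u = 0 → e c u = 0} * radCard B = Fintype.card V := by
  have h1 : Nat.card (LinearMap.range B) * Nat.card (LinearMap.ker B) = Nat.card V := by
    rw [Submodule.card_eq_card_quotient_mul_card (LinearMap.ker B), mul_comm,
      Nat.card_congr B.quotKerEquivRange.toEquiv, mul_comm]
  have h2 : Nat.card (LinearMap.ker B) = radCard B := by
    rw [radCard, ← Fintype.card_subtype, ← Nat.card_eq_fintype_card]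
    exact Nat.card_congr (Equiv.subtypeEquivRight fun u => by simp)
  have h3 : Nat.card (LinearMap.range B) = #{c | ∀ u, B u = 0 → e c u = 0} := by
    rw [← Fintype.card_subtype, ← Nat.card_eq_fintype_card]
    refine (Nat.card_congr (e.toEquiv.subtypeEquiv fun c => ?_)).symm
    have hflip : B.flip = B := by
      ext x y
      exact hB y x
    have := LinearMap.dualAnnihilator_ker_eq_range_flip (B := B)
    rw [hflip] at this
    change _ ↔ e c ∈ LinearMap.range B
    rw [← this, Submodule.mem_dualAnnihilator]
    rfl
  rw [← h3, ← h2, h1, Nat.card_eq_fintype_card]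

/-- The number of pairs `(c, h)` for which `halfQuad B + e c + h` is zero on exactly a
proportion `1 / p` of all points. -/
theorem card_balanced (hp : Odd p) (B : V →ₗ[ZMod p] V →ₗ[ZMod p] ZMod p)
    (hB : ∀ x y, B x y = B y x) (e : V ≃ₗ[ZMod p] Module.Dual (ZMod p) V)
    {m ρ : ℕ} (hm : Even m) (hV : Fintype.card V = p ^ m) (hρ : radCard B = p ^ ρ) :
    (#{t : V × ZMod p | p * #{x | halfQuad B x + e t.1 x + t.2 = 0} = p ^ m} : ℤ) * p ^ ρ
      = p * (p ^ m * p ^ ρ - p ^ m) + (if Odd ρ then p ^ m else 0) := by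
  have h1 : #{t : V × ZMod p | p * #{x | halfQuad B x + e t.1 x + t.2 = 0} = p ^ m}
      = ∑ c : V, #{h | p * #{x | halfQuad B x + e c x + h = 0} = p ^ m} := by
    simp only [card_filter]
    rw [← univ_product_univ, sum_product]
  have h2 : ∀ c : V, #{h | p * #{x | halfQuad B x + e c x + h = 0} = p ^ m}
      = if (∀ u, B u = 0 → e c u = 0) then (if Odd ρ then 1 else 0) else p := by
    intro c
    split_ifs with hc ho
    · obtain ⟨k, hk⟩ := zeros_of_mem_radical hp B hB (e c) hc
      have := card_fibreDev_eq_zero hp B hB hm hV hρ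
      rw [if_pos ho] at this
      rw [← this]
      refine card_bij (fun h _ => k - h) ?_ ?_ ?_
      · intro h hh
        simp only [mem_filter, mem_univ, true_and] at hh ⊢
        rw [hk h] at hh
        rw [fibreDev, sub_eq_zero, hV]
        exact_mod_cast hh
      · intro x _ y _ h
        exact sub_right_injective h
      · intro h hh
        refine ⟨k - h, ?_, by simp⟩
        simp only [mem_filter, mem_univ, true_and] at hh ⊢
        rw [hk, sub_sub_cancel]
        rw [fibreDev, sub_eq_zero, hV] at hh
        exact_mod_cast hh
    · obtain ⟨k, hk⟩ := zeros_of_mem_radical hp B hB (e c) hc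
      have := card_fibreDev_eq_zero hp B hB hm hV hρ
      rw [if_neg ho, card_eq_zero, filter_eq_empty_iff] at this
      rw [card_eq_zero, filter_eq_empty_iff]
      intro h _ hh
      rw [hk h] at hh
      refine this (mem_univ (k - h)) ?_
      rw [fibreDev, sub_eq_zero, hV]
      exact_mod_cast hh
    · push Not at hc
      obtain ⟨u, hu, hcu⟩ := hc
      rw [filter_true_of_mem, card_univ, ZMod.card]
      intro h _
      rw [zeros_of_not_mem_radical hp B hB (e c) hu hcu h, hV]
  have h3 := card_annihilator_radical B hB e
  have h4 : #{c | ∀ u, B u = 0 → e c u = 0} + #{c | ¬ ∀ u, B u = 0 → e c u = 0}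
      = Fintype.card V := by
    rw [card_filter_add_card_filter_not, card_univ]
  rw [h1, Finset.sum_congr rfl fun c _ => h2 c, Finset.sum_ite, sum_const, sum_const]
  simp only [smul_eq_mul]
  rw [hρ, hV] at h3
  rw [hV] at h4
  generalize #{c | ∀ u, B u = 0 → e c u = 0} = A at h3 h4 ⊢
  generalize #{c | ¬ ∀ u, B u = 0 → e c u = 0} = A' at h4 ⊢
  have h3' : (A : ℤ) * p ^ ρ = p ^ m := by exact_mod_cast h3
  have h4' : (A : ℤ) + A' = p ^ m := by exact_mod_cast h4
  split_ifs
  · push_cast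
    linear_combination (1 - (p : ℤ)) * h3' + (p : ℤ) * p ^ ρ * h4'
  · push_cast
    linear_combination (- (p : ℤ)) * h3' + (p : ℤ) * p ^ ρ * h4'

end QuadraticFibres

section Radical

variable {F : Type} [Field F] {σ τ κ : F →+* F}

/-- An automorphism `σ` with inverse `τ` and a commuting involution `κ`, such that no nonzero
element is negated by both `σ` and `κ`. -/
structure IsTwist (σ τ κ : F →+* F) : Prop where
  two_ne : (2 : F) ≠ 0
  στ : ∀ x, σ (τ x) = x
  τσ : ∀ x, τ (σ x) = x
  κκ : ∀ x, κ (κ x) = x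
  σκ : ∀ x, σ (κ x) = κ (σ x)
  τκ : ∀ x, τ (κ x) = κ (τ x)
  eq_zero_of_neg : ∀ u, σ u = -u → κ u = -u → u = 0

/-- The additive map whose kernel is the radical of the form attached to `(a, b)`. -/
def radMap (σ τ κ : F →+* F) (a b t : F) : F := a * κ t + b * σ t + τ (b * t)

theorem mul_radMap_mul (H : IsTwist σ τ κ) (a b x t : F) :
    x * radMap σ τ κ a b (x * t) = radMap σ τ κ (a * (x * κ x)) (b * (x * σ x)) t := by
  simp only [radMap, map_mul, H.τσ]
  ring

theorem radMap_one (a b : F) : radMap σ τ κ a b 1 = a + (b + τ b) := by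
  simp [radMap, add_assoc]

theorem fixed_of_radMap_one (H : IsTwist σ τ κ) {a β : F} (ha : κ a = a)
    (h : radMap σ τ κ a β 1 = 0) : κ β = β ∧ a = -(β + τ β) := by
  rw [radMap_one] at h
  have ha' : a = -(β + τ β) := by linear_combination h
  refine ⟨?_, ha'⟩
  rw [ha', map_neg, map_add] at ha
  have h1 : τ (β - κ β) = -(β - κ β) := by
    rw [map_sub, H.τκ]
    linear_combination ha
  have h2 : σ (β - κ β) = -(β - κ β) := by
    have := congrArg σ h1
    rw [H.στ, map_neg] at this
    linear_combination this
  have h3 : κ (β - κ β) = -(β - κ β) := by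
    rw [map_sub, H.κκ]; ring
  have := H.eq_zero_of_neg _ h2 h3
  linear_combination -this

theorem κ_norm (H : IsTwist σ τ κ) (x : F) : κ (x * κ x) = x * κ x := by
  rw [map_mul, H.κκ, mul_comm]

theorem radMap_eq_zero_iff (H : IsTwist σ τ κ) {β : F} (hβ : κ β = β) (hβ0 : β ≠ 0) (t : F) :
    radMap σ τ κ (-(β + τ β)) β t = 0 ↔
      κ t = t ∧ σ (β * (σ t - t)) = β * (σ t - t) := by
  have hτβ : κ (τ β) = τ β := by rw [← H.τκ, hβ]
  constructor
  · intro h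
    have hκ : κ t = t := by
      have h' := congrArg κ h
      simp only [radMap, map_add, map_mul, map_neg, hβ, hτβ, H.κκ, map_zero, ← H.σκ, ← H.τκ] at h h'
      set u := t - κ t with hu
      have hκu : κ u = -u := by rw [hu, map_sub, H.κκ]; ring
      have e1 : β * (σ u + u) + τ (β * (σ u + u)) = 0 := by
        simp only [map_mul, map_add, H.τσ]
        rw [hu]
        simp only [map_sub]
        linear_combination h - h'
      have e2 : σ (β * (σ u + u)) = -(β * (σ u + u)) := by
        have := congrArg σ e1
        rw [map_add, H.στ, map_zero] at this
        linear_combination this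
      have e3 : κ (β * (σ u + u)) = -(β * (σ u + u)) := by
        rw [map_mul, map_add, ← H.σκ, hκu, hβ, map_neg]; ring
      have e4 := H.eq_zero_of_neg _ e2 e3
      have e5 : σ u = -u := by
        rcases mul_eq_zero.mp e4 with h | h
        · exact absurd h hβ0
        · linear_combination h
      have := H.eq_zero_of_neg _ e5 hκu
      rw [hu] at this
      linear_combination -this
    refine ⟨hκ, ?_⟩
    rw [radMap, hκ] at h
    have e1 : β * (σ t - t) = τ (β * (σ t - t)) := by
      simp only [map_mul, map_sub, H.τσ] at h ⊢
      linear_combination h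
    nth_rewrite 1 [e1]
    rw [H.στ]
  · rintro ⟨hκ, h⟩
    have e1 := congrArg τ h
    rw [H.τσ] at e1
    rw [radMap, hκ]
    simp only [map_mul, map_sub, H.τσ] at e1 ⊢
    linear_combination e1

variable [Fintype F] [DecidableEq F]

/-- The image of `t ↦ σ t - t` on the fixed field of `κ`. -/
def diffImage (σ κ : F →+* F) : Finset F := ({t | κ t = t} : Finset F).image fun t => σ t - t

theorem card_fibre_diff {w : F} (hw : w ∈ diffImage σ κ) :
    #{t | κ t = t ∧ σ t - t = w} = #{t | κ t = t ∧ σ t = t} := by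
  simp only [diffImage, mem_image, mem_filter, mem_univ, true_and] at hw
  obtain ⟨t₀, h0, rfl⟩ := hw
  refine card_bij (fun t _ => t - t₀) ?_ ?_ ?_
  · intro t ht
    simp only [mem_filter, mem_univ, true_and] at ht ⊢
    refine ⟨by rw [map_sub, ht.1, h0], ?_⟩
    rw [map_sub]
    linear_combination ht.2
  · intro x _ y _ h
    exact sub_left_injective h
  · intro t ht
    simp only [mem_filter, mem_univ, true_and] at ht
    refine ⟨t + t₀, ?_, by simp⟩
    simp only [mem_filter, mem_univ, true_and]
    refine ⟨by rw [map_add, ht.1, h0], ?_⟩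
    rw [map_add]
    linear_combination ht.2

theorem card_filter_diff (P : F → Prop) [DecidablePred P] :
    #{t | κ t = t ∧ P (σ t - t)}
      = #{w ∈ diffImage σ κ | P w} * #{t | κ t = t ∧ σ t = t} := by
  rw [card_eq_sum_card_fiberwise (f := fun t => σ t - t) (t := {w ∈ diffImage σ κ | P w})]
  · rw [Finset.sum_congr rfl (g := fun _ => #{t | κ t = t ∧ σ t = t}), sum_const, smul_eq_mul]
    intro w hw
    rw [mem_filter] at hw
    rw [← card_fibre_diff hw.1, filter_filter]
    congr 1
    ext t
    simp only [mem_filter, mem_univ, true_and]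
    constructor
    · rintro ⟨⟨h1, _⟩, h3⟩; exact ⟨h1, h3⟩
    · rintro ⟨h1, h3⟩; exact ⟨⟨h1, h3 ▸ hw.2⟩, h3⟩
  · intro t ht
    simp only [coe_filter, mem_univ, true_and, Set.mem_ofPred_eq] at ht ⊢
    exact ⟨mem_image.mpr ⟨t, by simpa using ht.1, rfl⟩, ht.2⟩

theorem card_fixed_eq_mul :
    #{t | κ t = t} = #(diffImage σ κ) * #{t | κ t = t ∧ σ t = t} := by
  simpa using card_filter_diff (σ := σ) (κ := κ) (fun _ => True)

theorem card_radical (H : IsTwist σ τ κ) {β : F} (hβ : κ β = β) (hβ0 : β ≠ 0) :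
    #{t | radMap σ τ κ (-(β + τ β)) β t = 0} =
      if β⁻¹ ∈ diffImage σ κ then #{t | κ t = t ∧ σ t = t} ^ 2
      else #{t | κ t = t ∧ σ t = t} := by
  simp only [radMap_eq_zero_iff H hβ hβ0]
  rw [card_filter_diff (σ := σ) (κ := κ) (fun w => σ (β * w) = β * w)]
  split_ifs with hI
  · rw [sq]
    congr 1
    simp only [diffImage, mem_image, mem_filter, mem_univ, true_and] at hI
    obtain ⟨t₀, h0, h1⟩ := hI
    refine card_bij (fun w _ => β * w) ?_ ?_ ?_
    · intro w hw
      simp only [diffImage, mem_image, mem_filter, mem_univ, true_and] at hw ⊢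
      obtain ⟨⟨t, ht, rfl⟩, h2⟩ := hw
      exact ⟨by rw [map_mul, map_sub, ← H.σκ, ht, hβ], h2⟩
    · intro x _ y _ h
      exact mul_left_cancel₀ hβ0 h
    · intro e he
      simp only [mem_filter, mem_univ, true_and] at he
      refine ⟨β⁻¹ * e, ?_, by field_simp⟩
      simp only [diffImage, mem_image, mem_filter, mem_univ, true_and]
      refine ⟨⟨t₀ * e, by rw [map_mul, h0, he.1], ?_⟩, ?_⟩
      · rw [map_mul, he.2, ← h1]; ring
      · rw [mul_inv_cancel_left₀ hβ0, he.2]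
  · have : #{w ∈ diffImage σ κ | σ (β * w) = β * w} = 1 := by
      rw [card_eq_one]
      refine ⟨0, ?_⟩
      ext w
      simp only [diffImage, mem_image, mem_filter, mem_univ, true_and, mem_singleton] at hI ⊢
      constructor
      · rintro ⟨⟨t, ht, rfl⟩, h2⟩
        by_contra hw
        have he0 : β * (σ t - t) ≠ 0 := mul_ne_zero hβ0 hw
        refine hI ⟨t / (β * (σ t - t)), ?_, ?_⟩
        · rw [map_div₀, map_mul, map_sub, ← H.σκ, ht, hβ]
        · rw [map_div₀, h2, ← sub_div]
          field_simp
      · rintro rfl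
        exact ⟨⟨0, by simp, by simp⟩, by simp⟩
    rw [this, one_mul]

theorem card_radical_eq_sq (H : IsTwist σ τ κ) :
    #{β | (κ β = β ∧ β ≠ 0) ∧ β⁻¹ ∈ diffImage σ κ} = #(diffImage σ κ) - 1 := by
  have h0 : (0 : F) ∈ diffImage σ κ := mem_image.mpr ⟨0, by simp, by simp⟩
  rw [← card_erase_of_mem h0]
  refine card_bij (fun β _ => β⁻¹) ?_ ?_ ?_
  · intro β hβ
    simp only [mem_filter, mem_univ, true_and] at hβ
    exact mem_erase.mpr ⟨inv_ne_zero hβ.1.2, hβ.2⟩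
  · intro x _ y _ h
    exact inv_injective h
  · intro w hw
    rw [mem_erase] at hw
    refine ⟨w⁻¹, ?_, inv_inv w⟩
    simp only [mem_filter, mem_univ, true_and, inv_inv]
    refine ⟨⟨?_, inv_ne_zero hw.1⟩, hw.2⟩
    obtain ⟨t, ht, rfl⟩ := mem_image.mp hw.2
    simp only [mem_filter, mem_univ, true_and] at ht
    rw [map_inv₀, map_sub, ← H.σκ, ht]

/-- The number of zeros of `radMap`. -/
def radSize (σ τ κ : F →+* F) (a b : F) : ℕ := #{t | radMap σ τ κ a b t = 0}

theorem radSize_mul (H : IsTwist σ τ κ) (a b : F) {x : F} (hx : x ≠ 0) :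
    radSize σ τ κ (a * (x * κ x)) (b * (x * σ x)) = radSize σ τ κ a b := by
  refine card_bij (fun t _ => x * t) ?_ ?_ ?_
  · intro t ht
    simp only [mem_filter, mem_univ, true_and, ← mul_radMap_mul H] at ht ⊢
    exact (mul_eq_zero.mp ht).resolve_left hx
  · intro s _ t _ h
    exact mul_left_cancel₀ hx h
  · intro t ht
    refine ⟨x⁻¹ * t, ?_, by field_simp⟩
    simp only [mem_filter, mem_univ, true_and, ← mul_radMap_mul H] at ht ⊢
    rw [mul_inv_cancel_left₀ hx, ht, mul_zero]

theorem card_pairs_vanishing (H : IsTwist σ τ κ) (ρ : ℕ) {x : F} (hx : x ≠ 0) :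
    #{ab : F × F | ((κ ab.1 = ab.1 ∧ ab ≠ 0) ∧ radSize σ τ κ ab.1 ab.2 = ρ) ∧
        radMap σ τ κ ab.1 ab.2 x = 0}
      = #{β | (κ β = β ∧ β ≠ 0) ∧ radSize σ τ κ (-(β + τ β)) β = ρ} := by
  have hσx : σ x ≠ 0 := by simpa using hx
  have hκx : κ x ≠ 0 := by simpa using hx
  have key : ∀ a b : F, κ a = a → radMap σ τ κ a b x = 0 →
      κ (b * (x * σ x)) = b * (x * σ x) ∧
        a * (x * κ x) = -(b * (x * σ x) + τ (b * (x * σ x))) := by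
    intro a b ha h
    refine fixed_of_radMap_one H (by rw [map_mul, κ_norm H, ha]) ?_
    rw [← mul_radMap_mul H, mul_one, h, mul_zero]
  refine card_bij (fun ab _ => ab.2 * (x * σ x)) ?_ ?_ ?_
  · rintro ⟨a, b⟩ hab
    simp only [mem_filter, mem_univ, true_and] at hab ⊢
    obtain ⟨⟨⟨ha, h0⟩, hr⟩, hz⟩ := hab
    obtain ⟨h1, h2⟩ := key a b ha hz
    refine ⟨⟨h1, ?_⟩, ?_⟩
    · intro hb
      rw [hb] at h2
      simp only [map_zero, add_zero, neg_zero] at h2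
      apply h0
      simp_all
    · rw [← h2, radSize_mul H a b hx, hr]
  · rintro ⟨a, b⟩ hab ⟨a', b'⟩ hab' h
    simp only [mem_filter, mem_univ, true_and] at hab hab' h
    obtain ⟨h1, h2⟩ := key a b hab.1.1.1 hab.2
    obtain ⟨h1', h2'⟩ := key a' b' hab'.1.1.1 hab'.2
    rw [h, ← h2'] at h2
    rw [mul_right_cancel₀ (mul_ne_zero hx hκx) h2, mul_right_cancel₀ (mul_ne_zero hx hσx) h]
  · intro β hβ
    simp only [mem_filter, mem_univ, true_and] at hβ
    obtain ⟨⟨h1, h2⟩, h3⟩ := hβ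
    have e1 : β / (x * σ x) * (x * σ x) = β := by field_simp
    have e2 : -(β + τ β) / (x * κ x) * (x * κ x) = -(β + τ β) := by field_simp
    refine ⟨(-(β + τ β) / (x * κ x), β / (x * σ x)), ?_, e1⟩
    simp only [mem_filter, mem_univ, true_and]
    refine ⟨⟨⟨?_, ?_⟩, ?_⟩, ?_⟩
    · rw [map_div₀, κ_norm H, map_neg, map_add, ← H.τκ, h1]
    · intro h
      have := (Prod.ext_iff.mp h).2
      simp only [Prod.snd_zero] at this
      rw [this, zero_mul] at e1
      exact h2 e1.symm
    · rw [← radSize_mul H _ _ hx, e1, e2, h3]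
    · have := mul_radMap_mul H (-(β + τ β) / (x * κ x)) (β / (x * σ x)) x 1
      rw [e1, e2, mul_one, radMap_one] at this
      have h5 := (mul_eq_zero.mp (this.trans (by ring))).resolve_left hx
      exact h5

theorem card_pairs_mul (H : IsTwist σ τ κ) (ρ : ℕ) :
    #{ab : F × F | (κ ab.1 = ab.1 ∧ ab ≠ 0) ∧ radSize σ τ κ ab.1 ab.2 = ρ} * (ρ - 1)
      = (Fintype.card F - 1) *
        #{β | (κ β = β ∧ β ≠ 0) ∧ radSize σ τ κ (-(β + τ β)) β = ρ} := by
  have h := sum_card_bipartiteAbove_eq_sum_card_bipartiteBelow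
    (s := {ab : F × F | (κ ab.1 = ab.1 ∧ ab ≠ 0) ∧ radSize σ τ κ ab.1 ab.2 = ρ})
    (t := (univ : Finset F).erase 0) (fun ab x => radMap σ τ κ ab.1 ab.2 x = 0)
  rw [Finset.sum_congr rfl (g := fun _ => ρ - 1), sum_const, smul_eq_mul,
    Finset.sum_congr rfl (s₁ := (univ : Finset F).erase 0)
    (g := fun _ => #{β | (κ β = β ∧ β ≠ 0) ∧ radSize σ τ κ (-(β + τ β)) β = ρ}),
    sum_const, smul_eq_mul, card_erase_of_mem (mem_univ _), card_univ] at h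
  · exact h
  · intro x hx
    rw [← card_pairs_vanishing H ρ (ne_of_mem_erase hx), bipartiteBelow, filter_filter]
  · intro ab hab
    simp only [mem_filter, mem_univ, true_and] at hab
    rw [← hab.2, radSize, bipartiteAbove, filter_erase, card_erase_of_mem]
    simp [radMap]

theorem radSize_cases (H : IsTwist σ τ κ) {a b : F} (ha : κ a = a) (hab : (a, b) ≠ 0) :
    radSize σ τ κ a b = 1 ∨ radSize σ τ κ a b = #{t | κ t = t ∧ σ t = t} ∨
      radSize σ τ κ a b = #{t | κ t = t ∧ σ t = t} ^ 2 := by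
  by_cases h : ∃ x, x ≠ 0 ∧ radMap σ τ κ a b x = 0
  · right
    obtain ⟨x, hx, hz⟩ := h
    have h1 : 0 < #{ab : F × F | ((κ ab.1 = ab.1 ∧ ab ≠ 0) ∧
        radSize σ τ κ ab.1 ab.2 = radSize σ τ κ a b) ∧ radMap σ τ κ ab.1 ab.2 x = 0} :=
      card_pos.mpr ⟨(a, b), by simpa [ha, hz] using hab⟩
    rw [card_pairs_vanishing H _ hx] at h1
    obtain ⟨β, hβ⟩ := card_pos.mp h1
    simp only [mem_filter, mem_univ, true_and] at hβ
    rw [← hβ.2, radSize, card_radical H hβ.1.1 hβ.1.2]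
    split_ifs
    · exact Or.inr rfl
    · exact Or.inl rfl
  · left
    push Not at h
    rw [radSize, card_eq_one]
    refine ⟨0, ?_⟩
    ext x
    simp only [mem_filter, mem_univ, true_and, mem_singleton]
    constructor
    · intro hx
      by_contra h0
      exact h x h0 hx
    · rintro rfl
      simp [radMap]

theorem card_pairs_fst (H : IsTwist σ τ κ) (hK : 1 < #{t | κ t = t ∧ σ t = t}) :
    #{ab : F × F | (κ ab.1 = ab.1 ∧ ab ≠ 0) ∧
        radSize σ τ κ ab.1 ab.2 = #{t | κ t = t ∧ σ t = t}}
      = (Fintype.card F - 1) * #(diffImage σ κ) := by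
  have h1 := card_pairs_mul H #{t | κ t = t ∧ σ t = t}
  have h2 : #{β | (κ β = β ∧ β ≠ 0) ∧
      radSize σ τ κ (-(β + τ β)) β = #{t | κ t = t ∧ σ t = t}}
      + #{β | (κ β = β ∧ β ≠ 0) ∧ β⁻¹ ∈ diffImage σ κ} = #{β | κ β = β} - 1 := by
    have e : #(({β | κ β = β} : Finset F).erase 0) = #{β | κ β = β} - 1 :=
      card_erase_of_mem (by simp)
    rw [← e, ← card_filter_add_card_filter_not (s := ({β | κ β = β} : Finset F).erase 0)
      (fun β => β⁻¹ ∈ diffImage σ κ), add_comm]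
    congr 2
    · ext β
      simp only [mem_filter, mem_univ, true_and, mem_erase]
      tauto
    · ext β
      simp only [mem_filter, mem_univ, true_and, mem_erase]
      rw [and_comm (a := β ≠ 0)]
      refine and_congr_right fun hβ => ?_
      rw [radSize, card_radical H hβ.1 hβ.2]
      split_ifs with h
      · simp only [h, not_true_eq_false, iff_false]
        intro h
        nlinarith
      · simp [h]
  rw [card_radical_eq_sq H, card_fixed_eq_mul (σ := σ)] at h2
  have h0 : 0 < #(diffImage σ κ) := card_pos.mpr ⟨0, mem_image.mpr ⟨0, by simp, by simp⟩⟩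
  generalize #{t | κ t = t ∧ σ t = t} = K at *
  generalize #{β | (κ β = β ∧ β ≠ 0) ∧ radSize σ τ κ (-(β + τ β)) β = K} = M at *
  generalize #(diffImage σ κ) = I at *
  have h3 : M = I * (K - 1) := by
    obtain ⟨k, rfl⟩ : ∃ k, K = k + 1 := ⟨K - 1, by omega⟩
    rw [Nat.add_sub_cancel]
    rw [mul_add, mul_one] at h2
    omega
  rw [h3, ← mul_assoc] at h1
  exact Nat.eq_of_mul_eq_mul_right (by omega) h1

theorem card_pairs_snd (H : IsTwist σ τ κ) (hK : 1 < #{t | κ t = t ∧ σ t = t}) :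
    #{ab : F × F | (κ ab.1 = ab.1 ∧ ab ≠ 0) ∧
        radSize σ τ κ ab.1 ab.2 = #{t | κ t = t ∧ σ t = t} ^ 2}
        * (#{t | κ t = t ∧ σ t = t} ^ 2 - 1)
      = (Fintype.card F - 1) * (#(diffImage σ κ) - 1) := by
  rw [card_pairs_mul H, ← card_radical_eq_sq H]
  congr 2
  ext β
  simp only [mem_filter, mem_univ, true_and]
  refine and_congr_right fun hβ => ?_
  rw [radSize, card_radical H hβ.1 hβ.2]
  split_ifs with h
  · simp [h]
  · simp only [h, iff_false]
    intro h
    nlinarith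

end Radical

section CodeFunctions

variable {p : ℕ} [Fact p.Prime] {F : Type} [Field F] [Fintype F] [Algebra (ZMod p) F]
  {σ τ κ : F →+* F}

theorem trace_ringHom (φ : F →+* F) (x : F) :
    Algebra.trace (ZMod p) F (φ x) = Algebra.trace (ZMod p) F x := by
  let f : F →ₐ[ZMod p] F :=
    { φ with
      commutes' := fun r => RingHom.congr_fun
        (RingHom.ext_zmod (φ.comp (algebraMap (ZMod p) F)) (algebraMap (ZMod p) F)) r }
  exact Algebra.trace_eq_of_algEquiv
    (AlgEquiv.ofBijective f (Finite.injective_iff_bijective.mp f.toRingHom.injective)) x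

/-- The symmetric bilinear form `(x, y) ↦ Tr (radMap a b x * y)`. -/
noncomputable def codeForm (p : ℕ) [Fact p.Prime] [Algebra (ZMod p) F] (σ τ κ : F →+* F) (a b : F) :
    F →ₗ[ZMod p] F →ₗ[ZMod p] ZMod p :=
  LinearMap.comp (Algebra.traceForm (ZMod p) F)
    ((AddMonoidHom.mk' (radMap σ τ κ a b)
      (fun x y => by simp only [radMap, map_add, mul_add]; ring)).toZModLinearMap p)

theorem codeForm_apply (a b x y : F) :
    codeForm p σ τ κ a b x y = Algebra.trace (ZMod p) F (radMap σ τ κ a b x * y) := rfl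

theorem codeForm_symm (H : IsTwist σ τ κ) {a : F} (ha : κ a = a) (b x y : F) :
    codeForm p σ τ κ a b x y = codeForm p σ τ κ a b y x := by
  simp only [codeForm_apply, radMap, add_mul, map_add]
  have h1 : Algebra.trace (ZMod p) F (a * κ x * y) = Algebra.trace (ZMod p) F (a * κ y * x) := by
    rw [← trace_ringHom κ]
    simp only [map_mul, ha, H.κκ]
    ring_nf
  have h2 : ∀ x y, Algebra.trace (ZMod p) F (b * σ x * y)
      = Algebra.trace (ZMod p) F (τ (b * y) * x) := by
    intro x y
    rw [← trace_ringHom τ]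
    simp only [map_mul, H.τσ]
    ring_nf
  rw [h1, h2 x y, h2 y x]
  ring

/-- The identification of `F` with its dual given by the trace form. -/
noncomputable def traceDual (p : ℕ) [Fact p.Prime] [Algebra (ZMod p) F] :
    F ≃ₗ[ZMod p] Module.Dual (ZMod p) F :=
  LinearMap.BilinForm.toDual (Algebra.traceForm (ZMod p) F) (traceForm_nondegenerate (ZMod p) F)

theorem traceDual_apply (c x : F) :
    traceDual p c x = Algebra.trace (ZMod p) F (c * x) := rfl

theorem codeForm_eq_zero_iff (a b x : F) :
    codeForm p σ τ κ a b x = 0 ↔ radMap σ τ κ a b x = 0 := by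
  rw [← (traceDual p).map_eq_zero_iff]
  rfl

theorem radCard_codeForm [DecidableEq F] (a b : F) :
    radCard (codeForm p σ τ κ a b) = radSize σ τ κ a b := by
  simp only [radCard, radSize, codeForm_eq_zero_iff]

/-- The function with values in `ZMod p` described by the parameters `(a, b, c, h)`. -/
noncomputable def codeFn (p : ℕ) [Fact p.Prime] [Algebra (ZMod p) F] (σ τ κ : F →+* F)
    (t : F × F × F × ZMod p) (x : F) : ZMod p :=
  halfQuad (codeForm p σ τ κ t.1 t.2.1) x + traceDual p t.2.2.1 x + t.2.2.2

theorem halfQuad_codeForm (hp : Odd p) (H : IsTwist σ τ κ) (a b x : F) :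
    halfQuad (codeForm p σ τ κ a b) x
      = 2⁻¹ * Algebra.trace (ZMod p) F (a * (κ x * x)) + Algebra.trace (ZMod p) F (b * (σ x * x)) := by
  have h2 := zmod_two_ne_zero hp
  have h3 : Algebra.trace (ZMod p) F (τ (b * x) * x)
      = Algebra.trace (ZMod p) F (b * (σ x * x)) := by
    rw [← trace_ringHom σ, map_mul, H.στ]
    ring_nf
  rw [halfQuad, codeForm_apply, radMap, add_mul, add_mul, map_add, map_add, h3]
  have e : b * σ x * x = b * (σ x * x) := by ring
  rw [e, mul_assoc a]
  field_simp
  ring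

theorem codeFn_sub_smul (t t' : F × F × F × ZMod p) (k : ZMod p) (x : F) :
    codeFn p σ τ κ (t - k • t') x = codeFn p σ τ κ t x - k * codeFn p σ τ κ t' x := by
  have h : radMap σ τ κ (t.1 - k • t'.1) (t.2.1 - k • t'.2.1) x
      = radMap σ τ κ t.1 t.2.1 x - k • radMap σ τ κ t'.1 t'.2.1 x := by
    simp only [radMap, sub_mul, smul_mul_assoc, map_sub, ZMod.map_smul, smul_add]
    ring
  simp only [codeFn, halfQuad, codeForm_apply, traceDual_apply, Prod.fst_sub, Prod.snd_sub,
    Prod.smul_fst, Prod.smul_snd, h]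
  simp only [sub_mul, smul_mul_assoc, map_sub, map_smul, smul_eq_mul]
  ring

theorem codeFn_zero (x : F) : codeFn p σ τ κ 0 x = 0 := by
  have := codeFn_sub_smul (σ := σ) (τ := τ) (κ := κ) (p := p) 0 0 1 x
  simpa using this

theorem codeFn_smul (t : F × F × F × ZMod p) (k : ZMod p) (x : F) :
    codeFn p σ τ κ (k • t) x = k * codeFn p σ τ κ t x := by
  have := codeFn_sub_smul (σ := σ) (τ := τ) (κ := κ) 0 t (-k) x
  simpa [codeFn_zero] using this

theorem exists_codeFn_affine (hp : Odd p) (H : IsTwist σ τ κ) {t : F × F × F × ZMod p}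
    (ht : κ t.1 = t.1) (u v : F) :
    ∃ t' : F × F × F × ZMod p, κ t'.1 = t'.1 ∧
      ∀ x, codeFn p σ τ κ t' x = codeFn p σ τ κ t (u * x + v) := by
  obtain ⟨a, b, c, h⟩ := t
  simp only at ht
  refine ⟨(a * (u * κ u), b * (u * σ u), radMap σ τ κ a b v * u + c * u,
    halfQuad (codeForm p σ τ κ a b) v + traceDual p c v + h), ?_, fun x => ?_⟩
  · rw [map_mul, κ_norm H, ht]
  · simp only [codeFn]
    rw [halfQuad_add hp _ (codeForm_symm H ht b), codeForm_symm H ht b (u * x) v]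
    have h1 : halfQuad (codeForm p σ τ κ a b) (u * x)
        = halfQuad (codeForm p σ τ κ (a * (u * κ u)) (b * (u * σ u))) x := by
      simp only [halfQuad, codeForm_apply, ← mul_radMap_mul H]
      ring_nf
    rw [h1]
    simp only [codeForm_apply, traceDual_apply]
    simp only [mul_add, add_mul, map_add, mul_assoc]
    ring

variable [DecidableEq F]

theorem zeros_lt (hp : Odd p) (H : IsTwist σ τ κ) {d e : ℕ} (he : 1 ≤ e)
    (hq : Fintype.card F = p ^ (2 * (d + e)))
    (hK : #{t | κ t = t ∧ σ t = t} = p ^ d) {t : F × F × F × ZMod p} (ht : κ t.1 = t.1)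
    (ht0 : t ≠ 0) : p * #{x | codeFn p σ τ κ t x = 0} < 2 * Fintype.card F := by
  obtain ⟨a, b, c, h⟩ := t
  simp only at ht
  have hpp : p.Prime := Fact.out
  by_cases hab : (a, b) = 0
  · obtain ⟨rfl, rfl⟩ := Prod.mk_eq_zero.mp hab
    have hB : ∀ x, halfQuad (codeForm p σ τ κ 0 0) x = 0 := fun x => by
      simp [halfQuad, codeForm_apply, radMap]
    simp only [codeFn, hB, zero_add]
    by_cases hc : c = 0
    · have hh : h ≠ 0 := by
        rintro rfl
        exact ht0 (by rw [hc]; rfl)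
      simp [hc, hh, Fintype.card_pos]
    · have := card_fibre_linear (traceDual p c) (by simpa using hc) (-h)
      simp only [eq_neg_iff_add_eq_zero] at this
      rw [this]
      have := Fintype.card_pos (α := F)
      omega
  · have h1 := zeros_dev_sq_lt hp (codeForm p σ τ κ a b) (codeForm_symm H ht b) (traceDual p c) h
    have h2 : radSize σ τ κ a b ≤ p ^ (2 * d) := by
      have h1d : 1 ≤ p ^ d := Nat.one_le_pow _ _ hpp.pos
      rcases radSize_cases H ht hab with h | h | h
      · rw [h]; exact Nat.one_le_pow _ _ hpp.pos
      · rw [h, hK, mul_comm, pow_mul]; nlinarith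
      · rw [h, hK, mul_comm, pow_mul]
    rw [radCard_codeForm] at h1
    have h3 : (p : ℤ) ^ 2 * (Fintype.card F * radSize σ τ κ a b) ≤ (Fintype.card F : ℤ) ^ 2 := by
      have : p ^ 2 * (Fintype.card F * radSize σ τ κ a b) ≤ (Fintype.card F) ^ 2 := by
        calc _ ≤ p ^ 2 * (Fintype.card F * p ^ (2 * d)) := by gcongr
          _ = Fintype.card F * p ^ (2 * (d + 1)) := by ring
          _ ≤ Fintype.card F * p ^ (2 * (d + e)) := by
            gcongr
            exact hpp.one_le
          _ = _ := by rw [← hq, sq]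
      exact_mod_cast this
    have h4 := abs_lt_of_sq_lt_sq (h1.trans_le h3) (by positivity)
    have h5 := (abs_lt.mp h4).2
    have h6 : #{x | codeFn p σ τ κ (a, b, c, h) x = 0}
        = #{x | halfQuad (codeForm p σ τ κ a b) x + traceDual p c x + h = 0} := rfl
    have : (p : ℤ) * #{x | codeFn p σ τ κ (a, b, c, h) x = 0} < 2 * Fintype.card F := by
      rw [h6]
      linarith
    exact_mod_cast this

/-- The parameters of the functions that vanish on exactly a proportion `1 / p` of all points. -/
noncomputable def balancedParams (p : ℕ) [Fact p.Prime] [Algebra (ZMod p) F] (σ τ κ : F →+* F) :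
    Finset (F × F × F × ZMod p) :=
  {t | κ t.1 = t.1 ∧ p * #{x | codeFn p σ τ κ t x = 0} = Fintype.card F}

theorem card_balancedParams_fibre (hp : Odd p) (H : IsTwist σ τ κ) {s ρ : ℕ}
    (hq : Fintype.card F = p ^ (2 * s)) {a b : F} (ha : κ a = a)
    (hρ : radSize σ τ κ a b = p ^ ρ) :
    (#{t ∈ balancedParams p σ τ κ | (t.1, t.2.1) = (a, b)} : ℤ) * p ^ ρ
      = p * (p ^ (2 * s) * p ^ ρ - p ^ (2 * s)) + (if Odd ρ then p ^ (2 * s) else 0) := by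
  rw [← card_balanced hp (codeForm p σ τ κ a b) (codeForm_symm H ha b) (traceDual p)
    (even_two_mul s) hq (by rw [radCard_codeForm, hρ])]
  congr 2
  refine card_bij (fun t _ => (t.2.2.1, t.2.2.2)) ?_ ?_ ?_
  · rintro ⟨a', b', c, h⟩ ht
    simp only [balancedParams, mem_filter, mem_univ, true_and, Prod.mk.injEq] at ht ⊢
    obtain ⟨⟨_, h1⟩, rfl, rfl⟩ := ht
    rw [← hq]
    exact h1
  · rintro ⟨a', b', c, h⟩ ht ⟨a'', b'', c', h'⟩ ht' heq
    simp only [balancedParams, mem_filter, mem_univ, true_and, Prod.mk.injEq] at ht ht' heq ⊢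
    exact ⟨ht.2.1.trans ht'.2.1.symm, ht.2.2.trans ht'.2.2.symm, heq⟩
  · rintro ⟨c, h⟩ hch
    refine ⟨(a, b, c, h), ?_, rfl⟩
    simp only [balancedParams, mem_filter, mem_univ, true_and, and_true] at hch ⊢
    exact ⟨ha, by rw [hq]; exact hch⟩

theorem card_balancedParams (hp : Odd p) (H : IsTwist σ τ κ) {d e : ℕ} (hd : Odd d)
    (hq : Fintype.card F = p ^ (2 * (d + e)))
    (hK : #{t | κ t = t ∧ σ t = t} = p ^ d) (hκ : #{t | κ t = t} = p ^ (d + e)) :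
    (#(balancedParams p σ τ κ) : ℤ) = (p ^ (2 * (d + e)) - 1) *
      (p * p ^ (2 * d + 3 * e) - p * p ^ (d + 3 * e) + p ^ (d + 3 * e) + p * p ^ (3 * e)
        - p * p ^ (2 * e) + p) := by
  have hpp : p.Prime := Fact.out
  have hd0 : d ≠ 0 := by rintro rfl; exact absurd hd (by decide)
  have hK1 : 1 < p ^ d := Nat.one_lt_pow hd0 hpp.one_lt
  have hK2 : 1 < p ^ (2 * d) := Nat.one_lt_pow (by omega) hpp.one_lt
  have hKK : p ^ d < p ^ (2 * d) := Nat.pow_lt_pow_right hpp.one_lt (by omega)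
  have hI : #(diffImage σ κ) = p ^ e := by
    have := card_fixed_eq_mul (σ := σ) (κ := κ)
    rw [hK, hκ, pow_add, mul_comm] at this
    exact (Nat.eq_of_mul_eq_mul_right (by omega) this).symm
  have hn1 := card_pairs_fst H (by rw [hK]; exact hK1)
  have hn2 := card_pairs_snd H (by rw [hK]; exact hK1)
  rw [hK, hI, hq] at hn1
  rw [hK, hI, hq, ← pow_mul, mul_comm d 2] at hn2
  set n1 := #{ab : F × F | (κ ab.1 = ab.1 ∧ ab ≠ 0) ∧ radSize σ τ κ ab.1 ab.2 = p ^ d}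
  set n2 := #{ab : F × F | (κ ab.1 = ab.1 ∧ ab ≠ 0) ∧ radSize σ τ κ ab.1 ab.2 = p ^ (2 * d)}
  set N : F × F → ℤ := fun ab => #{t ∈ balancedParams p σ τ κ | (t.1, t.2.1) = ab} with hN
  have hsum : (#(balancedParams p σ τ κ) : ℤ) = ∑ ab : F × F with κ ab.1 = ab.1, N ab := by
    rw [card_eq_sum_card_fiberwise (f := fun t => (t.1, t.2.1))
      (t := ({ab | κ ab.1 = ab.1} : Finset (F × F)))]
    · push_cast; rfl
    · intro t ht
      simp only [balancedParams, coe_filter, mem_univ, true_and, Set.mem_ofPred_eq] at ht ⊢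
      exact ht.1
  have hp0 : (p : ℤ) ≠ 0 := by exact_mod_cast hpp.ne_zero
  have hN0 : N 0 = p * (p ^ (2 * (d + e)) - 1) := by
    have h := card_balancedParams_fibre (a := 0) (b := 0) (ρ := 2 * (d + e)) hp H hq (map_zero κ)
      (by simp [radSize, radMap, hq])
    rw [if_neg (by simp)] at h
    refine mul_right_cancel₀ (pow_ne_zero (2 * (d + e)) hp0) (h.trans ?_)
    ring
  have hNab : ∀ ab : F × F, κ ab.1 = ab.1 ∧ ab ≠ 0 →
      N ab = (if radSize σ τ κ ab.1 ab.2 = p ^ d then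
          (p : ℤ) * (p ^ (2 * (d + e)) - p ^ (d + 2 * e)) + p ^ (d + 2 * e) else 0)
        + (if radSize σ τ κ ab.1 ab.2 = p ^ (2 * d) then
          (p : ℤ) * (p ^ (2 * (d + e)) - p ^ (2 * e)) else 0) := by
    rintro ⟨a, b⟩ ⟨ha, hab⟩
    simp only at ha
    have hcases := radSize_cases H ha hab
    rw [hK, ← pow_mul, mul_comm d 2] at hcases
    rcases hcases with h | h | h
    · simp only [h]
      rw [if_neg (by omega), if_neg (by omega)]
      have h' := card_balancedParams_fibre (a := a) (b := b) (ρ := 0) hp H hq ha (by simpa using h)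
      rw [if_neg (by simp)] at h'
      have h'' : N (a, b) * p ^ 0 = _ := h'
      rw [pow_zero, mul_one] at h''
      rw [h'']
      ring
    · simp only [h]
      rw [if_pos trivial, if_neg (by omega)]
      have h' := card_balancedParams_fibre (a := a) (b := b) (ρ := d) hp H hq ha h
      rw [if_pos hd] at h'
      refine mul_right_cancel₀ (pow_ne_zero d hp0) (h'.trans ?_)
      push_cast
      ring
    · simp only [h]
      rw [if_neg (by omega), if_pos trivial]
      have h' := card_balancedParams_fibre (a := a) (b := b) (ρ := 2 * d) hp H hq ha h
      rw [if_neg (by simp)] at h'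
      refine mul_right_cancel₀ (pow_ne_zero (2 * d) hp0) (h'.trans ?_)
      push_cast
      ring
  have hsplit : ∑ ab : F × F with κ ab.1 = ab.1, N ab
      = N 0 + ∑ ab : F × F with κ ab.1 = ab.1 ∧ ab ≠ 0, N ab := by
    rw [← Finset.add_sum_erase _ _ (a := (0 : F × F)) (by simp)]
    congr 2
    ext ab
    simp [and_comm]
  have hn1' : (n1 : ℤ) = (p ^ (2 * (d + e)) - 1) * p ^ e := by
    rw [hn1]
    push_cast [Nat.one_le_pow (2 * (d + e)) p hpp.pos]
    ring
  have hn2' : (n2 : ℤ) * (p ^ (2 * d) - 1) = (p ^ (2 * (d + e)) - 1) * (p ^ e - 1) := by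
    have := congrArg (Nat.cast (R := ℤ)) hn2
    push_cast [Nat.one_le_pow (2 * (d + e)) p hpp.pos, Nat.one_le_pow (2 * d) p hpp.pos,
      Nat.one_le_pow e p hpp.pos] at this
    exact this
  rw [hsum, hsplit, hN0, Finset.sum_congr rfl fun ab hab => hNab ab (by simpa using hab),
    Finset.sum_add_distrib, ← Finset.sum_filter, ← Finset.sum_filter, filter_filter, filter_filter,
    sum_const, sum_const, nsmul_eq_mul, nsmul_eq_mul]
  change _ + ((n1 : ℤ) * _ + (n2 : ℤ) * _) = _
  rw [hn1']
  linear_combination (p : ℤ) * p ^ (2 * e) * hn2'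

end CodeFunctions

section Supports

variable {F : Type} [Fintype F] [DecidableEq F]

/-- A family of blocks of size `i` that is invariant under a doubly transitive group of
affine substitutions is a `2`-design; its index is determined by double counting. -/
theorem card_blocks_mul [Field F] (𝒮 : Finset (Finset F)) (i : ℕ) (hi : ∀ S ∈ 𝒮, #S = i)
    (hcl : ∀ S ∈ 𝒮, ∀ u v : F, u ≠ 0 → ({x | u * x + v ∈ S} : Finset F) ∈ 𝒮) {x y : F}
    (hxy : x ≠ y) :
    #{S ∈ 𝒮 | x ∈ S ∧ y ∈ S} * (Fintype.card F * (Fintype.card F - 1)) = #𝒮 * (i * (i - 1)) := by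
  have hle : ∀ x y x' y' : F, x ≠ y → x' ≠ y' →
      #{S ∈ 𝒮 | x ∈ S ∧ y ∈ S} ≤ #{S ∈ 𝒮 | x' ∈ S ∧ y' ∈ S} := by
    intro x y x' y' h h'
    have h1 : x' - y' ≠ 0 := sub_ne_zero.mpr h'
    have h2 : x - y ≠ 0 := sub_ne_zero.mpr h
    obtain ⟨u, v, hu, hx, hy⟩ : ∃ u v : F, u ≠ 0 ∧ u * x' + v = x ∧ u * y' + v = y := by
      refine ⟨(x - y) / (x' - y'), x - (x - y) / (x' - y') * x', div_ne_zero h2 h1, by ring, ?_⟩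
      field_simp
      ring
    refine card_le_card_of_injOn (fun S => ({z | u * z + v ∈ S} : Finset F)) ?_ ?_
    · intro S hS
      simp only [coe_filter, Set.mem_ofPred_eq, mem_filter, mem_univ, true_and, hx, hy] at hS ⊢
      exact ⟨hcl S hS.1 u v hu, hS.2⟩
    · intro S _ T _ hST
      ext z
      have := Finset.ext_iff.mp hST ((z - v) / u)
      simp only [mem_filter, mem_univ, true_and] at this
      rwa [mul_div_cancel₀ _ hu, sub_add_cancel] at this
  have hcount := sum_card_bipartiteAbove_eq_sum_card_bipartiteBelow (s := 𝒮)
    (t := (univ : Finset F).offDiag) (fun S z => z.1 ∈ S ∧ z.2 ∈ S)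
  have hL : ∀ S ∈ 𝒮, #(bipartiteAbove (fun (S : Finset F) (z : F × F) => z.1 ∈ S ∧ z.2 ∈ S)
      (univ : Finset F).offDiag S) = i * (i - 1) := by
    intro S hS
    have : bipartiteAbove (fun (S : Finset F) (z : F × F) => z.1 ∈ S ∧ z.2 ∈ S)
        (univ : Finset F).offDiag S = S.offDiag := by
      ext z
      simp only [mem_bipartiteAbove, mem_offDiag, mem_univ, true_and]
      tauto
    rw [this, offDiag_card, hi S hS, Nat.mul_sub_one]
  have hR : ∀ z ∈ (univ : Finset F).offDiag,
      #(bipartiteBelow (fun (S : Finset F) (z : F × F) => z.1 ∈ S ∧ z.2 ∈ S) 𝒮 z)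
        = #{S ∈ 𝒮 | x ∈ S ∧ y ∈ S} := by
    intro z hz
    have hz' : z.1 ≠ z.2 := by simpa using hz
    exact le_antisymm (hle _ _ _ _ hz' hxy) (hle _ _ _ _ hxy hz')
  rw [sum_congr rfl hL, sum_congr rfl hR, sum_const, sum_const, offDiag_card, smul_eq_mul,
    smul_eq_mul, card_univ, ← Nat.mul_sub_one] at hcount
  rw [mul_comm, ← hcount]

variable {p : ℕ} [Fact p.Prime] [Field F] [Algebra (ZMod p) F] {σ τ κ : F →+* F}

/-- The set of points where the function with given parameters does not vanish. -/
noncomputable def codeSupp (p : ℕ) [Fact p.Prime] [Algebra (ZMod p) F] (σ τ κ : F →+* F)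
    (t : F × F × F × ZMod p) : Finset F :=
  {x | codeFn p σ τ κ t x ≠ 0}

theorem card_zeros_add_card_codeSupp (t : F × F × F × ZMod p) :
    #{x | codeFn p σ τ κ t x = 0} + #(codeSupp p σ τ κ t) = Fintype.card F := by
  rw [codeSupp, card_filter_add_card_filter_not, card_univ]

theorem codeSupp_smul (t : F × F × F × ZMod p) {k : ZMod p} (hk : k ≠ 0) :
    codeSupp p σ τ κ (k • t) = codeSupp p σ τ κ t := by
  simp [codeSupp, codeFn_smul, hk]

theorem mem_balancedParams {t : F × F × F × ZMod p} :
    t ∈ balancedParams p σ τ κ ↔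
      κ t.1 = t.1 ∧ p * #(codeSupp p σ τ κ t) = (p - 1) * Fintype.card F := by
  simp only [balancedParams, mem_filter, mem_univ, true_and]
  refine and_congr_right fun _ => ?_
  have h := card_zeros_add_card_codeSupp (σ := σ) (τ := τ) (κ := κ) t
  have hp : 1 ≤ p := (Fact.out : p.Prime).one_le
  have h1 : p * #{x | codeFn p σ τ κ t x = 0} + p * #(codeSupp p σ τ κ t) = p * Fintype.card F := by
    rw [← mul_add, h]
  have h2 : (p - 1) * Fintype.card F + Fintype.card F = p * Fintype.card F := by
    rw [← add_one_mul, Nat.sub_add_cancel hp]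
  omega

theorem smul_mem_balancedParams {t : F × F × F × ZMod p} (ht : t ∈ balancedParams p σ τ κ)
    {k : ZMod p} (hk : k ≠ 0) : k • t ∈ balancedParams p σ τ κ := by
  rw [mem_balancedParams] at ht ⊢
  rw [codeSupp_smul t hk]
  exact ⟨by rw [Prod.smul_fst, ZMod.map_smul, ht.1], ht.2⟩

theorem preimage_codeSupp_mem (hp : Odd p) (H : IsTwist σ τ κ) {S : Finset F}
    (hS : S ∈ (balancedParams p σ τ κ).image (codeSupp p σ τ κ)) {u : F} (hu : u ≠ 0) (v : F) :
    ({x | u * x + v ∈ S} : Finset F) ∈ (balancedParams p σ τ κ).image (codeSupp p σ τ κ) := by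
  obtain ⟨t, ht, rfl⟩ := mem_image.mp hS
  rw [mem_balancedParams] at ht
  obtain ⟨t', ht', hx⟩ := exists_codeFn_affine hp H ht.1 u v
  have hS' : codeSupp p σ τ κ t' = ({x | u * x + v ∈ codeSupp p σ τ κ t} : Finset F) := by
    ext x
    simp [codeSupp, hx]
  refine mem_image.mpr ⟨t', mem_balancedParams.mpr ⟨ht', ?_⟩, hS'⟩
  rw [← ht.2, hS']
  congr 1
  refine card_bij (fun x _ => u * x + v) ?_ ?_ ?_
  · intro x hx
    simpa using hx
  · intro x _ y _ h
    exact mul_left_cancel₀ hu (add_right_cancel h)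
  · intro z hz
    refine ⟨(z - v) / u, ?_, ?_⟩
    · rw [mem_filter, mul_div_cancel₀ _ hu, sub_add_cancel]
      exact ⟨mem_univ _, hz⟩
    · rw [mul_div_cancel₀ _ hu, sub_add_cancel]

theorem exists_eq_smul_of_codeSupp_eq (hp : Odd p) (H : IsTwist σ τ κ) {d e : ℕ} (he : 1 ≤ e)
    (hq : Fintype.card F = p ^ (2 * (d + e)))
    (hK : #{t | κ t = t ∧ σ t = t} = p ^ d) {t t' : F × F × F × ZMod p}
    (ht : t ∈ balancedParams p σ τ κ) (ht' : t' ∈ balancedParams p σ τ κ)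
    (h : codeSupp p σ τ κ t = codeSupp p σ τ κ t') : ∃ k : ZMod p, k ≠ 0 ∧ t = k • t' := by
  by_contra! hne
  have hpp : p.Prime := Fact.out
  rw [mem_balancedParams] at ht ht'
  set S := codeSupp p σ τ κ t' with hS
  have hz : #{x | codeFn p σ τ κ t x = 0} + #S = Fintype.card F := by
    rw [← h, card_zeros_add_card_codeSupp]
  have hsum : #S = ∑ k ∈ univ.erase (0 : ZMod p),
      #{x ∈ S | codeFn p σ τ κ t x / codeFn p σ τ κ t' x = k} := by
    refine card_eq_sum_card_fiberwise fun x hx => ?_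
    have h1 : codeFn p σ τ κ t' x ≠ 0 := by simpa [hS, codeSupp] using hx
    have h2 : codeFn p σ τ κ t x ≠ 0 := by
      have hx' : x ∈ codeSupp p σ τ κ t := by rw [h]; exact hx
      simpa [codeSupp] using hx'
    simp [h1, h2]
  have hlt : ∀ k ∈ univ.erase (0 : ZMod p),
      p * #{x ∈ S | codeFn p σ τ κ t x / codeFn p σ τ κ t' x = k} < Fintype.card F := by
    intro k hk
    have hk0 : k ≠ 0 := (mem_erase.mp hk).1
    have h1 := zeros_lt (t := t - k • t') hp H he hq hK
      (by rw [Prod.fst_sub, Prod.smul_fst, map_sub, ZMod.map_smul, ht.1, ht'.1])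
      (sub_ne_zero.mpr (hne k hk0))
    have h2 : #{x ∈ S | codeFn p σ τ κ t x / codeFn p σ τ κ t' x = k}
        + #{x | codeFn p σ τ κ t x = 0} ≤ #{x | codeFn p σ τ κ (t - k • t') x = 0} := by
      rw [← card_union_of_disjoint]
      · refine card_le_card fun x hx => ?_
        simp only [mem_union, mem_filter, mem_univ, true_and, codeFn_sub_smul] at hx ⊢
        rcases hx with ⟨hx, hx'⟩ | hx
        · have h1 : codeFn p σ τ κ t' x ≠ 0 := by simpa [hS, codeSupp] using hx
          rw [div_eq_iff h1] at hx'
          rw [hx', sub_self]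
        · have : x ∉ S := by rw [← h]; simp [codeSupp, hx]
          have h1 : codeFn p σ τ κ t' x = 0 := by simpa [hS, codeSupp] using this
          rw [hx, h1, mul_zero, sub_self]
      · rw [disjoint_left]
        intro x hx hx'
        rw [mem_filter, ← h] at hx
        simp only [codeSupp, mem_filter, mem_univ, true_and] at hx hx'
        exact hx.1 hx'
    have h3 := Nat.mul_le_mul_left p h2
    have h4 : p * #{x | codeFn p σ τ κ t x = 0} + p * #S = p * Fintype.card F := by
      rw [← mul_add, hz]
    have h5 : (p - 1) * Fintype.card F + Fintype.card F = p * Fintype.card F := by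
      rw [← add_one_mul, Nat.sub_add_cancel hpp.one_le]
    rw [mul_add] at h3
    omega
  have hne' : (univ.erase (0 : ZMod p)).Nonempty := ⟨1, by simp⟩
  have h6 := sum_lt_sum_of_nonempty hne' hlt
  rw [← mul_sum, ← hsum, sum_const, card_erase_of_mem (mem_univ _), card_univ, ZMod.card,
    smul_eq_mul] at h6
  omega

theorem card_image_codeSupp (hp : Odd p) (H : IsTwist σ τ κ) {d e : ℕ} (he : 1 ≤ e)
    (hq : Fintype.card F = p ^ (2 * (d + e)))
    (hK : #{t | κ t = t ∧ σ t = t} = p ^ d) :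
    #((balancedParams p σ τ κ).image (codeSupp p σ τ κ)) * (p - 1)
      = #(balancedParams p σ τ κ) := by
  have hpp : p.Prime := Fact.out
  rw [card_eq_sum_card_image (codeSupp p σ τ κ) (balancedParams p σ τ κ), ← smul_eq_mul,
    ← sum_const]
  refine sum_congr rfl fun S hS => ?_
  obtain ⟨t, ht, rfl⟩ := mem_image.mp hS
  have ht0 : t ≠ 0 := by
    rintro rfl
    have h := (mem_balancedParams.mp ht).2
    have h0 : codeSupp p σ τ κ 0 = ∅ := by simp [codeSupp, codeFn_zero]
    rw [h0, card_empty, mul_zero, eq_comm, mul_eq_zero] at h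
    have := Fintype.card_pos (α := F)
    have := hpp.two_le
    omega
  have : p - 1 = #(univ.erase (0 : ZMod p)) := by
    rw [card_erase_of_mem (mem_univ _), card_univ, ZMod.card]
  rw [this]
  refine card_bij (fun k _ => k • t) ?_ ?_ ?_
  · intro k hk
    have hk0 : k ≠ 0 := (mem_erase.mp hk).1
    exact mem_filter.mpr ⟨smul_mem_balancedParams ht hk0, codeSupp_smul t hk0⟩
  · intro k _ k' _ h
    exact smul_left_injective _ ht0 h
  · intro t' ht'
    rw [mem_filter] at ht'
    obtain ⟨k, hk, rfl⟩ := exists_eq_smul_of_codeSupp_eq hp H he hq hK ht'.1 ht ht'.2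
    exact ⟨k, by simpa using hk, rfl⟩

end Supports

section Frobenius

variable {p : ℕ} [Fact p.Prime] {F : Type} [Field F] [CharP F p]

theorem pow_pow_mul_of_neg (hp : Odd p) {u : F} {k : ℕ} (h : u ^ p ^ k = -u) (n : ℕ) :
    u ^ p ^ (k * n) = (-1) ^ n * u := by
  induction n with
  | zero => simp
  | succ n ih =>
    have h1 : ((-1 : F) ^ n) ^ p ^ k = (-1) ^ n := by
      rw [← pow_mul, mul_comm, pow_mul, (hp.pow).neg_one_pow]
    rw [Nat.mul_succ, pow_add, pow_mul, ih, mul_pow, h, h1, pow_succ]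
    ring

variable [Fintype F] [DecidableEq F]

theorem card_pow_pow_fixed {n k : ℕ} (hF : Fintype.card F = p ^ n) (hk : k ∣ n) (hk0 : k ≠ 0) :
    #{t : F | t ^ p ^ k = t} = p ^ k := by
  have hpp : p.Prime := Fact.out
  have h1 : 1 < p ^ k := Nat.one_lt_pow hk0 hpp.one_lt
  have h2 : Nat.card (powMonoidHom (p ^ k - 1) : Fˣ →* Fˣ).ker = p ^ k - 1 := by
    rw [IsCyclic.card_powMonoidHom_ker, Nat.card_eq_fintype_card, Fintype.card_units, hF]
    exact Nat.gcd_eq_right (Nat.pow_sub_one_dvd_pow_sub_one p hk)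
  have h3 : #(({t : F | t ^ p ^ k = t} : Finset F).erase 0) = p ^ k - 1 := by
    rw [← h2, Nat.subtype_card (s := ({u | u ^ (p ^ k - 1) = 1} : Finset Fˣ))
      (by simp [MonoidHom.mem_ker])]
    symm
    refine card_bij (fun u _ => (u : F)) ?_ ?_ ?_
    · intro u hu
      have hu' : u ^ (p ^ k - 1) = 1 := (mem_filter.mp hu).2
      have : (u : F) ^ (p ^ k - 1) = 1 := by
        rw [← Units.val_pow_eq_pow_val, hu', Units.val_one]
      simp only [mem_erase, ne_eq, Units.ne_zero, not_false_eq_true, mem_filter, mem_univ, true_and]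
      rw [← Nat.sub_add_cancel h1.le, pow_succ, this, one_mul]
    · intro u _ v _ h
      exact Units.ext h
    · intro t ht
      simp only [mem_erase, mem_filter, mem_univ, true_and] at ht
      refine ⟨Units.mk0 t ht.1, ?_, rfl⟩
      have : t ^ (p ^ k - 1) = 1 := by
        refine mul_right_cancel₀ ht.1 ?_
        rw [← pow_succ, Nat.sub_add_cancel h1.le, ht.2, one_mul]
      exact mem_filter.mpr ⟨mem_univ _, Units.ext (by simpa using this)⟩
  have h4 := card_erase_add_one (s := ({t : F | t ^ p ^ k = t} : Finset F)) (a := 0)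
    (by simp [hpp.ne_zero])
  omega

theorem odd_div_add_div {s l d : ℕ} (hd0 : 0 < d) {s' l' : ℕ} (hs : s = d * s') (hl : l = d * l')
    (hd : Nat.gcd (s + l) (2 * l) = d) : Odd (s' + l') := by
  by_contra h
  obtain ⟨k, hk⟩ := even_iff_two_dvd.mp (Nat.not_odd_iff_even.mp h)
  have h1 : 2 * d ∣ Nat.gcd (s + l) (2 * l) :=
    Nat.dvd_gcd ⟨k, by rw [hs, hl, ← mul_add, hk]; ring⟩ ⟨l', by rw [hl]; ring⟩
  rw [hd] at h1
  have := Nat.le_of_dvd hd0 h1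
  omega

theorem isTwist_iterateFrobenius (hp : Odd p) {s l d : ℕ} (hl2 : l ≤ 2 * s)
    (hF : Fintype.card F = p ^ (2 * s)) (hd0 : 0 < d) (hds : d ∣ s) (hdl : d ∣ l)
    (hd : Nat.gcd (s + l) (2 * l) = d) :
    IsTwist (iterateFrobenius F p l) (iterateFrobenius F p (2 * s - l))
      (iterateFrobenius F p s) := by
  have hfull : ∀ x : F, iterateFrobenius F p (2 * s) x = x := fun x => by
    rw [iterateFrobenius_def, ← hF, FiniteField.pow_card]
  have htwo : (2 : F) ≠ 0 := by
    refine Ring.two_ne_zero ?_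
    rw [ringChar.eq F p]
    rintro rfl
    exact absurd hp (by decide)
  refine ⟨htwo, fun x => ?_, fun x => ?_, fun x => ?_, fun x => ?_, fun x => ?_, ?_⟩
  · rw [← iterateFrobenius_add_apply, Nat.add_sub_cancel' hl2, hfull]
  · rw [← iterateFrobenius_add_apply, Nat.sub_add_cancel hl2, hfull]
  · rw [← iterateFrobenius_add_apply, ← two_mul, hfull]
  · rw [← iterateFrobenius_add_apply, ← iterateFrobenius_add_apply, add_comm]
  · rw [← iterateFrobenius_add_apply, ← iterateFrobenius_add_apply, add_comm]
  · intro u hu hu'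
    rw [iterateFrobenius_def] at hu hu'
    obtain ⟨s', hs'⟩ := hds
    obtain ⟨l', hl'⟩ := hdl
    have h1 := pow_pow_mul_of_neg hp hu s'
    have h2 := pow_pow_mul_of_neg hp hu' l'
    have h3 : l * s' = s * l' := by rw [hs', hl']; ring
    rw [h3, h2] at h1
    have h4 : (-1 : F) ^ (s' + l') * u = u := by
      rw [pow_add, mul_assoc, h1, ← mul_assoc, ← mul_pow]
      simp
    rw [(odd_div_add_div hd0 hs' hl' hd).neg_one_pow] at h4
    have h5 : 2 * u = 0 := by linear_combination -h4
    exact (mul_eq_zero.mp h5).resolve_left htwo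

theorem card_fixed_inter {s l d : ℕ} (hF : Fintype.card F = p ^ (2 * s)) (hd0 : 0 < d)
    (hd : Nat.gcd s l = d) :
    #{t : F | iterateFrobenius F p s t = t ∧ iterateFrobenius F p l t = t} = p ^ d := by
  rw [← card_pow_pow_fixed hF ((hd ▸ Nat.gcd_dvd_left s l).mul_left 2) hd0.ne']
  congr 1
  ext t
  simp only [mem_filter, mem_univ, true_and, ← iterateFrobenius_def, coe_iterateFrobenius]
  constructor
  · rintro ⟨h1, h2⟩
    rw [← hd]
    exact Function.IsPeriodicPt.gcd h1 h2
  · intro h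
    have h1 : d ∣ s := hd ▸ Nat.gcd_dvd_left s l
    have h2 : d ∣ l := hd ▸ Nat.gcd_dvd_right s l
    exact ⟨Function.IsPeriodicPt.trans_dvd h h1, Function.IsPeriodicPt.trans_dvd h h2⟩

theorem two_mul_trp {s : ℕ} {z : F} (hz : z ^ p ^ s = z) : 2 * trp p s z = trp p (2 * s) z := by
  rw [trp, trp, two_mul s, sum_range_add, two_mul]
  simp only [pow_add, pow_mul, hz]

theorem algebraMap_trace_eq_trp [Algebra (ZMod p) F] {n : ℕ} (hF : Fintype.card F = p ^ n) (z : F) :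
    algebraMap (ZMod p) F (Algebra.trace (ZMod p) F z) = trp p n z := by
  have h : Module.finrank (ZMod p) F = n := by
    have := Module.card_eq_pow_finrank (K := ZMod p) (V := F)
    rw [ZMod.card, hF] at this
    exact (Nat.pow_right_injective (Fact.out : p.Prime).two_le this).symm
  rw [FiniteField.algebraMap_trace_eq_sum_pow, h, Nat.card_zmod, trp]

theorem cword_eq [Algebra (ZMod p) F] (hp : Odd p) {s l : ℕ}
    (hF : Fintype.card F = p ^ (2 * s))
    (H : IsTwist (iterateFrobenius F p l) (iterateFrobenius F p (2 * s - l))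
      (iterateFrobenius F p s)) {a : F} (ha : a ^ p ^ s = a) (b c : F) (h : ZMod p) (x : F) :
    cword p s l a b c h x = algebraMap (ZMod p) F (codeFn p (iterateFrobenius F p l)
      (iterateFrobenius F p (2 * s - l)) (iterateFrobenius F p s) (a, b, c, h) x) := by
  have hfix : (a * x ^ (p ^ s + 1)) ^ p ^ s = a * x ^ (p ^ s + 1) := by
    have := κ_norm H x
    simp only [iterateFrobenius_def] at this
    rw [mul_pow, ha, pow_succ', this]
  have h1 := two_mul_trp hfix
  have h2 : (algebraMap (ZMod p) F 2) = 2 := map_ofNat _ 2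
  have h3 : (ZMod.cast h : F) = algebraMap (ZMod p) F h := by
    rw [← ZMod.castHom_apply (h := dvd_rfl)]
    exact RingHom.congr_fun (RingHom.ext_zmod _ _) h
  have h4 : ∀ y z : F, trp p (2 * s) (y + z) = trp p (2 * s) y + trp p (2 * s) z := by
    intro y z
    simp only [← algebraMap_trace_eq_trp hF, map_add]
  rw [cword, codeFn, halfQuad_codeForm hp H, traceDual_apply]
  simp only [map_add, map_mul, map_inv₀, h2, algebraMap_trace_eq_trp hF, iterateFrobenius_def,
    ← pow_succ, ← h1, h3, h4]
  rw [inv_mul_cancel_left₀ H.two_ne]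
  ring

end Frobenius

theorem stmt14 (p s l : ℕ) [Fact p.Prime] (F : Type) [Field F] [Fintype F] [DecidableEq F]
    [CharP F p] (hodd : Odd p) (hs : 2 ≤ s) (hl1 : 1 ≤ l) (hls : l ≠ s)
    (hl2 : l ≤ 2 * s - 1) (hF : Fintype.card F = p ^ (2 * s)) (d : ℕ)
    (hd : Nat.gcd s l = d) (hd' : Nat.gcd (s + l) (2 * l) = d) (hdodd : Odd d) :
    (∀ S ∈ (((Finset.univ : Finset (F × F × F × ZMod p)).filter fun t =>
        t.1 ^ p ^ s = t.1 ∧ (suppw p s l t.1 t.2.1 t.2.2.1 t.2.2.2).card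
            = p ^ (2 * s - 1) * (p - 1)).image
        fun t => suppw p s l t.1 t.2.1 t.2.2.1 t.2.2.2),
      S.card = p ^ (2 * s - 1) * (p - 1)) ∧
    ∀ x y : F, x ≠ y →
      (((((Finset.univ : Finset (F × F × F × ZMod p)).filter fun t =>
        t.1 ^ p ^ s = t.1 ∧ (suppw p s l t.1 t.2.1 t.2.2.1 t.2.2.2).card
            = p ^ (2 * s - 1) * (p - 1)).image
        fun t => suppw p s l t.1 t.2.1 t.2.2.1 t.2.2.2).filter
        fun S => x ∈ S ∧ y ∈ S).card : ℚ)
        = ((p : ℚ) ^ (2 * s) - (p : ℚ) ^ (2 * s - 1) - 1)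
          * ((p : ℚ) ^ (3 * s - d) - (p : ℚ) ^ (3 * s - 2 * d) + (p : ℚ) ^ (3 * s - 2 * d - 1)
            + (p : ℚ) ^ (3 * s - 3 * d) - (p : ℚ) ^ (2 * s - 2 * d) + 1) := by
  have hpp : p.Prime := Fact.out
  let : Algebra (ZMod p) F := ZMod.algebra F p
  have hd0 : 0 < d := hdodd.pos
  have hds : d ∣ s := hd ▸ Nat.gcd_dvd_left s l
  have hdl : d ∣ l := hd ▸ Nat.gcd_dvd_right s l
  obtain ⟨e, he, rfl⟩ : ∃ e, 1 ≤ e ∧ s = d + e := by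
    refine ⟨s - d, ?_, ?_⟩
    · have h1 := Nat.le_of_dvd (by omega) hds
      suffices s ≠ d by omega
      rintro rfl
      obtain ⟨k, rfl⟩ := hdl
      have h2 : k < 2 := by
        by_contra! h
        have := Nat.mul_le_mul_left s h
        omega
      interval_cases k <;> omega
    · have := Nat.le_of_dvd (by omega) hds
      omega
  set s := d + e with hs_def
  have H := isTwist_iterateFrobenius hodd (l := l) (by omega) hF hd0 hds hdl hd'
  have hK := card_fixed_inter hF hd0 hd
  have hκ : #{t : F | iterateFrobenius F p s t = t} = p ^ (d + e) := by
    simp only [iterateFrobenius_def]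
    exact card_pow_pow_fixed hF (Dvd.intro_left 2 rfl) (by omega)
  set σ := iterateFrobenius F p l
  set τ := iterateFrobenius F p (2 * s - l)
  set κ := iterateFrobenius F p s with hκ_def
  have hsupp : ∀ t : F × F × F × ZMod p, t.1 ^ p ^ s = t.1 →
      suppw p s l t.1 t.2.1 t.2.2.1 t.2.2.2 = codeSupp p σ τ κ t := by
    intro t ht
    ext x
    rw [suppw, codeSupp, mem_filter, mem_filter, cword_eq hodd hF H ht, ne_eq, ne_eq,
      map_eq_zero_iff _ (algebraMap (ZMod p) F).injective]
  have hq : p ^ (2 * s) = p * p ^ (2 * s - 1) := by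
    rw [← pow_succ', Nat.sub_add_cancel (by omega)]
  have himage : ((univ : Finset (F × F × F × ZMod p)).filter fun t =>
        t.1 ^ p ^ s = t.1 ∧ (suppw p s l t.1 t.2.1 t.2.2.1 t.2.2.2).card
            = p ^ (2 * s - 1) * (p - 1)).image
        (fun t => suppw p s l t.1 t.2.1 t.2.2.1 t.2.2.2)
      = (balancedParams p σ τ κ).image (codeSupp p σ τ κ) := by
    have hfilter : ((univ : Finset (F × F × F × ZMod p)).filter fun t =>
        t.1 ^ p ^ s = t.1 ∧ (suppw p s l t.1 t.2.1 t.2.2.1 t.2.2.2).card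
            = p ^ (2 * s - 1) * (p - 1)) = balancedParams p σ τ κ := by
      ext t
      rw [mem_filter, mem_balancedParams, hκ_def, iterateFrobenius_def, ← hκ_def]
      simp only [mem_univ, true_and]
      refine and_congr_right fun ht => ?_
      rw [hsupp t ht, hF, hq, mul_left_comm, mul_right_inj' hpp.ne_zero, mul_comm (p - 1)]
    rw [hfilter]
    refine image_congr fun t ht => hsupp t ?_
    have := (mem_balancedParams.mp (mem_coe.mp ht)).1
    rwa [hκ_def, iterateFrobenius_def] at this
  have hblock : ∀ S ∈ (balancedParams p σ τ κ).image (codeSupp p σ τ κ),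
      #S = p ^ (2 * s - 1) * (p - 1) := by
    intro S hS
    rw [← himage] at hS
    obtain ⟨t, ht, rfl⟩ := mem_image.mp hS
    exact (mem_filter.mp ht).2.2
  rw [himage]
  refine ⟨hblock, fun x y hxy => ?_⟩
  have h1 := card_blocks_mul _ _ hblock
    (fun S hS u v hu => preimage_codeSupp_mem hodd H hS hu v) hxy
  have h2 := card_image_codeSupp hodd H he hF hK
  have h3 := card_balancedParams hodd H hdodd hF hK hκ
  rw [hF] at h1
  set M := #{S ∈ (balancedParams p σ τ κ).image (codeSupp p σ τ κ) | x ∈ S ∧ y ∈ S}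
  set B := #((balancedParams p σ τ κ).image (codeSupp p σ τ κ))
  set N := #(balancedParams p σ τ κ)
  have hr : 1 ≤ p ^ (2 * s - 1) * (p - 1) :=
    Nat.mul_pos (pow_pos hpp.pos _) (by have := hpp.two_le; omega)
  have h1' : (M : ℚ) * (p ^ (2 * s) * (p ^ (2 * s) - 1))
      = B * (p ^ (2 * s - 1) * (p - 1) * (p ^ (2 * s - 1) * (p - 1) - 1)) := by
    have := congrArg (Nat.cast (R := ℚ)) h1
    push_cast [hr, Nat.one_le_pow (2 * s) p hpp.pos, hpp.one_le] at this
    exact this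
  have h2' : (B : ℚ) * (p - 1) = N := by
    have := congrArg (Nat.cast (R := ℚ)) h2
    push_cast [hpp.one_le] at this
    exact this
  have h3' : (N : ℚ) = (p ^ (2 * s) - 1) *
      (p * p ^ (2 * d + 3 * e) - p * p ^ (d + 3 * e) + p ^ (d + 3 * e) + p * p ^ (3 * e)
        - p * p ^ (2 * e) + p) := by
    exact_mod_cast congrArg (Int.cast (R := ℚ)) h3
  have hq' : (p : ℚ) ^ (2 * s) = p * p ^ (2 * s - 1) := by exact_mod_cast hq
  have hr' : (p : ℚ) ^ (d + 3 * e) = p * p ^ (d + 3 * e - 1) := by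
    rw [← pow_succ', Nat.sub_add_cancel (by omega)]
  have hp0 : (p : ℚ) ≠ 0 := by exact_mod_cast hpp.ne_zero
  have hq1 : (p : ℚ) ^ (2 * s) - 1 ≠ 0 :=
    sub_ne_zero.mpr (one_lt_pow₀ (by exact_mod_cast hpp.one_lt) (by omega)).ne'
  rw [show 3 * s - d = 2 * d + 3 * e by omega, show 3 * s - 2 * d = d + 3 * e by omega,
    show 3 * s - 3 * d = 3 * e by omega, show 2 * s - 2 * d = 2 * e by omega]
  refine mul_right_cancel₀ (mul_ne_zero (pow_ne_zero (2 * s) hp0) hq1) ?_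
  rw [h1']
  rw [← h2'] at h3'
  rw [hq'] at h3' ⊢
  rw [hr'] at h3' ⊢
  linear_combination (p : ℚ) ^ (2 * s - 1) * (p ^ (2 * s - 1) * (p - 1) - 1) * h3'
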